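/- arXiv:1203.4956 — 2 statements merged into one kernel-verified Lean document; each statement's English description precedes it below -/
import Mathlib

section
/- Let A be a C*-algebra and suppose every n-positive linear map A → A is (n+1)-positive (equivalently, completely positive). Then A is n-subhomogeneous. Conversely, if A is n-subhomogeneous then every n-positive map with domain A (into any C*-algebra B) is completely positive. -/
noncomputable section

/-- An element of a `*`-ring is positive if it is of the form `star b * b`.
(In a C*-algebra this is the usual positivity.) -/
def IsPosElem {A : Type*} [NonUnitalSemiring A] [StarRing A] (a : A) : Prop :=
  ∃ b, a = star b * b

/-- A linear map `φ : A → B` between `*`-algebras is `k`-positive if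
`φ ⊗ id_{M_k} : M_k(A) → M_k(B)` (i.e. the entrywise application of `φ`)
maps positive elements to positive elements. -/
def KPositive {A B : Type*} [NonUnitalRing A] [StarRing A] [Module ℂ A]
    [NonUnitalRing B] [StarRing B] [Module ℂ B] (k : ℕ) (φ : A →ₗ[ℂ] B) : Prop :=
  ∀ x : Matrix (Fin k) (Fin k) A, IsPosElem x → IsPosElem (x.map φ)

/-- A linear map is completely positive if it is `k`-positive for all `k`. -/
def CompletelyPositive {A B : Type*} [NonUnitalRing A] [StarRing A] [Module ℂ A]
    [NonUnitalRing B] [StarRing B] [Module ℂ B] (φ : A →ₗ[ℂ] B) : Prop :=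
  ∀ k : ℕ, KPositive k φ
def IsIrreducibleRep {A : Type*} [NonUnitalNonAssocSemiring A] [DistribMulAction ℂ A] [Star A]
    {H : Type*} [NormedAddCommGroup H] [InnerProductSpace ℂ H] [CompleteSpace H]
    (π : A →⋆ₙₐ[ℂ] (H →L[ℂ] H)) : Prop :=
  (∃ a, π a ≠ 0) ∧
    ∀ S : Submodule ℂ H, IsClosed (S : Set H) →
      (∀ a : A, ∀ v ∈ S, π a v ∈ S) → S = ⊥ ∨ S = ⊤

/-- A `*`-algebra is `n`-subhomogeneous if all its irreducible representations (on complex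
Hilbert spaces) have dimension at most `n`. -/
def IsSubhomogeneous (n : ℕ) (A : Type*) [NonUnitalNonAssocSemiring A]
    [DistribMulAction ℂ A] [Star A] : Prop :=
  ∀ (H : Type) [NormedAddCommGroup H] [InnerProductSpace ℂ H] [CompleteSpace H]
    (π : A →⋆ₙₐ[ℂ] (H →L[ℂ] H)), IsIrreducibleRep π → Module.rank ℂ H ≤ n

section Positivity

open scoped ComplexOrder

variable {A : Type*} [NonUnitalCStarAlgebra A]

lemma isPosElem_iff_nonneg [PartialOrder A] [StarOrderedRing A] {a : A} :
    IsPosElem a ↔ 0 ≤ a :=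
  CStarAlgebra.nonneg_iff_eq_star_mul_self.symm

lemma isPosElem_sum {ι : Type*} (s : Finset ι) (f : ι → A) (h : ∀ i ∈ s, IsPosElem (f i)) :
    IsPosElem (∑ i ∈ s, f i) := by
  let _ := CStarAlgebra.spectralOrder A
  have _ := CStarAlgebra.spectralOrderedRing A
  simp only [isPosElem_iff_nonneg] at *
  exact Finset.sum_nonneg h

lemma isPosElem_matrix_iff [PartialOrder A] [StarOrderedRing A] {k : ℕ}
    (x : Matrix (Fin k) (Fin k) A) : IsPosElem x ↔ 0 ≤ CStarMatrix.ofMatrix x :=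
  isPosElem_iff_nonneg (A := CStarMatrix (Fin k) (Fin k) A)

lemma isPosElem_matrix_sum {k : ℕ} {ι : Type*} (s : Finset ι)
    (f : ι → Matrix (Fin k) (Fin k) A) (h : ∀ i ∈ s, IsPosElem (f i)) :
    IsPosElem (∑ i ∈ s, f i) := by
  let _ := CStarAlgebra.spectralOrder A
  have _ := CStarAlgebra.spectralOrderedRing A
  exact isPosElem_sum (A := CStarMatrix (Fin k) (Fin k) A) s f h

lemma isPosElem_gram {k : ℕ} {ι : Type*} [Fintype ι] (c : ι → Fin k → A) :
    IsPosElem (Matrix.of fun p q => ∑ s, star (c s p) * c s q) := by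
  rcases k with _ | k
  · exact ⟨0, Subsingleton.elim _ _⟩
  have key : (Matrix.of fun p q => ∑ s, star (c s p) * c s q) =
      ∑ s, (Matrix.of fun p q => star (c s p) * c s q : Matrix (Fin (k+1)) (Fin (k+1)) A) := by
    ext p q
    simp [Matrix.sum_apply]
  rw [key]
  refine isPosElem_matrix_sum _ _ fun s _ => ⟨Matrix.of fun r q => if r = 0 then c s q else 0, ?_⟩
  ext p q
  simp [Matrix.mul_apply, Matrix.star_apply]

lemma IsPosElem.exists_gram {k : ℕ} {x : Matrix (Fin k) (Fin k) A} (hx : IsPosElem x) :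
    ∃ b : Fin k → Fin k → A, ∀ p q, x p q = ∑ r, star (b r p) * b r q := by
  obtain ⟨b, rfl⟩ := hx
  exact ⟨b, fun p q => by simp [Matrix.mul_apply, Matrix.star_apply]⟩

lemma IsSelfAdjoint.exists_eq_nonneg_sub_nonneg [PartialOrder A] [StarOrderedRing A] {a : A}
    (ha : IsSelfAdjoint a) : ∃ p m : A, 0 ≤ p ∧ 0 ≤ m ∧ a = p - m ∧ m * p = 0 :=
  ⟨a⁺, a⁻, CFC.posPart_nonneg a, CFC.negPart_nonneg a, (CFC.posPart_sub_negPart a ha).symm,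
    CFC.negPart_mul_posPart a⟩

lemma isPosElem_of_forall_column {k : ℕ} {T : Matrix (Fin k) (Fin k) A} (hT : star T = T)
    (h : ∀ S : Fin k → A, IsPosElem (∑ i, ∑ j, star (S i) * T i j * S j)) : IsPosElem T := by
  let _ := CStarAlgebra.spectralOrder A
  have _ := CStarAlgebra.spectralOrderedRing A
  rw [isPosElem_matrix_iff]
  set M : CStarMatrix (Fin k) (Fin k) A := CStarMatrix.ofMatrix T with hM
  have hMs : IsSelfAdjoint M := hT
  obtain ⟨P, N, hP, hneg, hMPN, hNP⟩ :=
    IsSelfAdjoint.exists_eq_nonneg_sub_nonneg (A := CStarMatrix (Fin k) (Fin k) A) hMs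
  have hns : star N = N := (IsSelfAdjoint.of_nonneg hneg).star_eq
  have h3 : N * M * N = - (N * N * N) := by
    conv_lhs => rw [hMPN]
    rw [mul_sub, hNP]
    simp
  have hcube : 0 ≤ N * N * N := by
    have := star_left_conjugate_nonneg hneg N
    rwa [hns] at this
  obtain ⟨c, hc⟩ :=
    (isPosElem_iff_nonneg (A := CStarMatrix (Fin k) (Fin k) A)).mpr hcube
  have hdiag : ∀ j, (star c * c) j j = 0 := by
    intro j
    apply le_antisymm
    · have := h (fun i => N i j)
      rw [isPosElem_iff_nonneg] at this
      have h4 : (N * M * N) j j = ∑ i, ∑ l, star (N i j) * T i l * N l j := by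
        nth_rewrite 1 [← hns]
        simp only [CStarMatrix.mul_apply, CStarMatrix.star_apply, Finset.sum_mul]
        rw [Finset.sum_comm]
        rfl
      rw [← h4, h3, hc] at this
      simpa using this
    · simp only [CStarMatrix.mul_apply, CStarMatrix.star_apply]
      exact Finset.sum_nonneg fun i _ => star_mul_self_nonneg _
  have hc0 : c = 0 := by
    ext i j
    have := hdiag j
    simp only [CStarMatrix.mul_apply, CStarMatrix.star_apply] at this
    rw [Finset.sum_eq_zero_iff_of_nonneg fun i _ => star_mul_self_nonneg _] at this
    simpa [CStarRing.star_mul_self_eq_zero_iff] using this i (Finset.mem_univ _)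
  have hn0 : N = 0 := by
    have h5 : star (N * N) * (N * N) = 0 := by
      rw [star_mul, hns]
      rw [hc0] at hc
      rw [mul_assoc, ← mul_assoc N N N, hc]
      simp
    rw [CStarRing.star_mul_self_eq_zero_iff] at h5
    rw [← CStarRing.star_mul_self_eq_zero_iff, hns, h5]
  rw [hMPN, hn0, sub_zero]
  exact hP

lemma exists_positive_functional_neg {h : A} (hh : star h = h) (hn : ¬ IsPosElem h) :
    ∃ ω : A →ₗ[ℂ] ℂ, (∀ b, 0 ≤ ω (star b * b)) ∧ (ω h).re < 0 := by
  let _ := CStarAlgebra.spectralOrder A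
  have _ := CStarAlgebra.spectralOrderedRing A
  rw [isPosElem_iff_nonneg] at hn
  let C : ProperCone ℝ A := ProperCone.positive ℝ A
  obtain ⟨f, hf, hfh⟩ := C.hyperplane_separation_point (x₀ := h) hn
  let g : Module.Dual ℝ A :=
    f.toLinearMap ∘ₗ (selfAdjoint.submodule ℝ A).subtype ∘ₗ realPart
  have hg : ∀ a : A, star a = a → (g.extendRCLike (𝕜 := ℂ)) a = (f a : ℂ) := by
    intro a ha
    have h1 : (realPart a : A) = a :=
      IsSelfAdjoint.coe_realPart ha
    have h2 : (realPart (Complex.I • a) : A) = 0 := by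
      have h3 := IsSelfAdjoint.imaginaryPart ha
      simp [realPart_I_smul, h3]
    have e1 : g a = f a := congrArg f h1
    have e2 : g (Complex.I • a) = 0 := (congrArg f h2).trans (map_zero f)
    rw [Module.Dual.extendRCLike_apply]
    simp [e1, e2]
  refine ⟨g.extendRCLike (𝕜 := ℂ), fun b => ?_, ?_⟩
  · rw [hg _ (by simp)]
    exact_mod_cast hf _ (star_mul_self_nonneg b)
  · rw [hg _ hh]
    exact hfh

end Positivity

section FiniteRank

variable {H : Type*} [NormedAddCommGroup H] [InnerProductSpace ℂ H]

lemma norm_sum_diag_sq_le {n : ℕ} {ι : Type*} [Fintype ι] (V : Submodule ℂ (EuclideanSpace ℂ ι))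
    (hV : Module.finrank ℂ V ≤ n) (m : ι → EuclideanSpace ℂ ι) (hm : ∀ i, m i ∈ V) :
    ‖∑ i, m i i‖ ^ 2 ≤ n * ∑ i, ‖m i‖ ^ 2 := by
  let b := stdOrthonormalBasis ℂ V
  let c : ι → Fin (Module.finrank ℂ V) → ℂ := fun i s => inner ℂ (b s) (⟨m i, hm i⟩ : V)
  have hmi : ∀ i j, m i j = ∑ s, c i s * (b s : EuclideanSpace ℂ ι) j := by
    intro i j
    have := congrArg (fun v : V => (v : EuclideanSpace ℂ ι) j) (b.sum_repr' ⟨m i, hm i⟩)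
    simpa [c] using this.symm
  have hnorm : ∀ i, ∑ s, ‖c i s‖ ^ 2 = ‖m i‖ ^ 2 := fun i =>
    b.sum_sq_norm_inner_right (⟨m i, hm i⟩ : V)
  have hb : ∑ i, ∑ s, ‖(b s : EuclideanSpace ℂ ι) i‖ ^ 2 ≤ n := by
    rw [Finset.sum_comm]
    have : ∀ s, ∑ i, ‖(b s : EuclideanSpace ℂ ι) i‖ ^ 2 = 1 := fun s => by
      rw [← EuclideanSpace.norm_sq_eq]
      have := b.orthonormal.1 s
      rw [Submodule.norm_coe, this, one_pow]
    simp only [this]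
    simpa using hV
  calc ‖∑ i, m i i‖ ^ 2
      ≤ (∑ p : ι × Fin (Module.finrank ℂ V), ‖c p.1 p.2‖ *
          ‖(b p.2 : EuclideanSpace ℂ ι) p.1‖) ^ 2 := by
        gcongr
        simp only [hmi, Fintype.sum_prod_type, ← norm_mul]
        exact (norm_sum_le _ _).trans (Finset.sum_le_sum fun i _ => norm_sum_le _ _)
    _ ≤ (∑ p : ι × Fin (Module.finrank ℂ V), ‖c p.1 p.2‖ ^ 2) *
          ∑ p : ι × Fin (Module.finrank ℂ V), ‖(b p.2 : EuclideanSpace ℂ ι) p.1‖ ^ 2 :=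
        Finset.sum_mul_sq_le_sq_mul_sq _ _ _
    _ ≤ (∑ i, ‖m i‖ ^ 2) * n := by
        simp only [Fintype.sum_prod_type, hnorm]
        gcongr
    _ = n * ∑ i, ‖m i‖ ^ 2 := mul_comm _ _

/-- The row inequality for operators on a space of dimension at most `n`. -/
lemma norm_sum_apply_sq_le {n : ℕ} {ι : Type*} [Fintype ι] {E : Type*} [AddCommGroup E]
    [Module ℂ E] [Module.Finite ℂ E] (hE : Module.finrank ℂ E ≤ n) (u : ι → E)
    (x : ι → E →ₗ[ℂ] H) :
    ‖∑ i, x i (u i)‖ ^ 2 ≤ n * ∑ k, ∑ i, ‖x k (u i)‖ ^ 2 := by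
  set g := ∑ i, x i (u i) with hg
  rcases eq_or_ne g 0 with h0 | h0
  · rw [h0, norm_zero, zero_pow two_ne_zero]
    positivity
  let Φ : E →ₗ[ℂ] EuclideanSpace ℂ ι :=
    (WithLp.linearEquiv 2 ℂ (ι → ℂ)).symm.toLinearMap ∘ₗ
      LinearMap.pi fun k => (innerSL ℂ g).toLinearMap ∘ₗ x k
  have hΦ : ∀ v k, Φ v k = inner ℂ g (x k v) := fun v k => rfl
  have h1 := norm_sum_diag_sq_le (LinearMap.range Φ)
    ((LinearMap.finrank_range_le Φ).trans hE) (fun i => Φ (u i)) (fun i => ⟨_, rfl⟩)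
  simp only [hΦ, ← inner_sum, EuclideanSpace.norm_sq_eq, ← hg] at h1
  rw [inner_self_eq_norm_sq_to_K] at h1
  have h2 : ∑ i, ∑ k, ‖inner ℂ g (x k (u i))‖ ^ 2 ≤ ‖g‖ ^ 2 * ∑ k, ∑ i, ‖x k (u i)‖ ^ 2 := by
    rw [Finset.sum_comm]
    simp only [Finset.mul_sum, ← mul_pow]
    gcongr
    exact norm_inner_le_norm _ _
  have h3 : ‖g‖ ^ 2 * ‖g‖ ^ 2 ≤ ‖g‖ ^ 2 * (n * ∑ k, ∑ i, ‖x k (u i)‖ ^ 2) := by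
    calc ‖g‖ ^ 2 * ‖g‖ ^ 2 ≤ n * ∑ i, ∑ k, ‖inner ℂ g (x k (u i))‖ ^ 2 := by
          convert h1 using 1
          simp [sq]
      _ ≤ n * (‖g‖ ^ 2 * ∑ k, ∑ i, ‖x k (u i)‖ ^ 2) := by gcongr
      _ = _ := by ring
  exact le_of_mul_le_mul_left h3 (by positivity)

/-- The diagonal amplification of a bounded operator. -/
def diagAmp (m : ℕ) (T : H →L[ℂ] H) :
    PiLp 2 (fun _ : Fin m => H) →L[ℂ] PiLp 2 (fun _ : Fin m => H) :=
  (PiLp.continuousLinearEquiv 2 ℂ (fun _ : Fin m => H)).symm.toContinuousLinearMap ∘L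
    (ContinuousLinearMap.pi fun i => T ∘L ContinuousLinearMap.proj i) ∘L
      (PiLp.continuousLinearEquiv 2 ℂ (fun _ : Fin m => H)).toContinuousLinearMap

@[simp]
lemma diagAmp_apply (m : ℕ) (T : H →L[ℂ] H) (v : PiLp 2 (fun _ : Fin m => H)) (i : Fin m) :
    diagAmp m T v i = T (v i) := rfl

/-- The coordinate embedding into a finite Hilbert sum. -/
def coordEmb (m : ℕ) (j : Fin m) : H →L[ℂ] PiLp 2 (fun _ : Fin m => H) :=
  (PiLp.continuousLinearEquiv 2 ℂ (fun _ : Fin m => H)).symm.toContinuousLinearMap ∘L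
    ContinuousLinearMap.single ℂ (fun _ : Fin m => H) j

lemma coordEmb_apply (m : ℕ) (j : Fin m) (x : H) (i : Fin m) :
    coordEmb m j x i = if i = j then x else 0 := by
  change (Pi.single j x : Fin m → H) i = _
  rw [Pi.single_apply]

lemma sum_coordEmb (m : ℕ) (v : PiLp 2 (fun _ : Fin m => H)) : ∑ j, coordEmb m j (v j) = v := by
  ext i
  simp [WithLp.ofLp_sum, coordEmb_apply]

end FiniteRank

section Irreducible

open Filter Topology

variable {A : Type*} [NonUnitalCStarAlgebra A]
  {H : Type*} [NormedAddCommGroup H] [InnerProductSpace ℂ H] [CompleteSpace H]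
  {π : A →⋆ₙₐ[ℂ] (H →L[ℂ] H)}

lemma IsIrreducibleRep.exists_eq_smul_of_isSelfAdjoint (hπ : IsIrreducibleRep π)
    {T : H →L[ℂ] H} (hT : IsSelfAdjoint T) (hc : ∀ a, Commute T (π a)) :
    ∃ r : ℝ, T = r • 1 := by
  suffices h : (spectrum ℝ T).Subsingleton by
    rcases h.eq_empty_or_singleton with h | ⟨r, h⟩
    · exact ⟨0, by
        rw [CFC.eq_algebraMap_of_spectrum_subset_singleton T (0 : ℝ) (by simp [h]) hT,
          Algebra.algebraMap_eq_smul_one]⟩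
    · exact ⟨r, by
        rw [CFC.eq_algebraMap_of_spectrum_subset_singleton T r h.subset hT,
          Algebra.algebraMap_eq_smul_one]⟩
  have key : ∀ x ∈ spectrum ℝ T, ∀ y ∈ spectrum ℝ T, ¬ x < y := by
    intro x hx y hy hxy
    let f : ℝ → ℝ := fun t => max 0 (t - (x + y) / 2)
    let g : ℝ → ℝ := fun t => max 0 ((x + y) / 2 - t)
    have hf : ContinuousOn f (spectrum ℝ T) := by fun_prop
    have hg : ContinuousOn g (spectrum ℝ T) := by fun_prop
    have hfg : cfc f T * cfc g T = 0 := by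
      rw [← cfc_mul f g T, ← cfc_zero ℝ T]
      congr 1
      ext t
      rcases le_total t ((x + y) / 2) with h | h
      · simp [f, max_eq_left (sub_nonpos.mpr h)]
      · simp [g, max_eq_left (sub_nonpos.mpr h)]
    have hf0 : cfc f T ≠ 0 := by
      rw [← cfc_zero ℝ T]
      intro h
      have := (cfc_eq_cfc_iff_eqOn (R := ℝ) hT hf (by fun_prop)).mp h hy
      simp only [f, Pi.zero_apply] at this
      have h2 := le_max_right 0 (y - (x + y) / 2)
      linarith
    have hg0 : cfc g T ≠ 0 := by
      rw [← cfc_zero ℝ T]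
      intro h
      have := (cfc_eq_cfc_iff_eqOn (R := ℝ) hT hg (by fun_prop)).mp h hx
      simp only [g, Pi.zero_apply] at this
      have h2 := le_max_right 0 ((x + y) / 2 - x)
      linarith
    rcases hπ.2 (LinearMap.ker (cfc f T).toLinearMap) (cfc f T).isClosed_ker (by
      intro a v hv
      have h1 := IsSelfAdjoint.commute_cfc hT (hc a) f
      have h2 := congrArg (fun S : H →L[ℂ] H => S v) h1.eq
      simp only [mul_apply_eq_comp] at h2
      change cfc f T v = 0 at hv
      change cfc f T (π a v) = 0
      rw [h2, hv, map_zero]) with h | h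
    · apply hg0
      ext v
      have : cfc g T v ∈ LinearMap.ker (cfc f T).toLinearMap := by
        change (cfc f T * cfc g T) v = 0
        rw [hfg]; rfl
      rw [h] at this
      exact this
    · apply hf0
      ext v
      have : v ∈ LinearMap.ker (cfc f T).toLinearMap := h ▸ Submodule.mem_top
      exact this
  intro x hx y hy
  exact le_antisymm (not_lt.mp (key y hy x hx)) (not_lt.mp (key x hx y hy))

/-- The Schur lemma for irreducible representations of C*-algebras. -/
lemma IsIrreducibleRep.exists_eq_smul (hπ : IsIrreducibleRep π)
    {T : H →L[ℂ] H} (hc : ∀ a, Commute T (π a)) : ∃ c : ℂ, T = c • 1 := by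
  have hs : ∀ a, Commute (star T) (π a) := fun a => by
    have := (hc (star a)).star_star
    rwa [map_star, star_star] at this
  obtain ⟨r, hr⟩ := hπ.exists_eq_smul_of_isSelfAdjoint (T := (realPart T : H →L[ℂ] H))
    (realPart T).2 (fun a => by
      rw [realPart_apply_coe]
      exact ((hc a).add_left (hs a)).smul_left _)
  obtain ⟨s, hs⟩ := hπ.exists_eq_smul_of_isSelfAdjoint (T := (imaginaryPart T : H →L[ℂ] H))
    (imaginaryPart T).2 (fun a => by
      rw [imaginaryPart_apply_coe]
      exact (((hc a).sub_left (hs a)).smul_left _).smul_left _)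
  refine ⟨r + Complex.I * s, ?_⟩
  rw [← realPart_add_I_smul_imaginaryPart T, hr, hs, add_smul, mul_smul]
  rfl

lemma IsIrreducibleRep.eq_zero_of_forall (hπ : IsIrreducibleRep π) {v : H}
    (hv : ∀ a, π a v = 0) : v = 0 := by
  let S : Submodule ℂ H := ⨅ a, LinearMap.ker (π a).toLinearMap
  have hmem : ∀ v, v ∈ S ↔ ∀ a, π a v = 0 := fun v => by
    simp [S, Submodule.mem_iInf]
  have hcl : IsClosed (S : Set H) := by
    have : (S : Set H) = ⋂ a, {v | π a v = 0} := by
      ext v; simp [hmem]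
    rw [this]
    exact isClosed_iInter fun a => isClosed_eq (π a).continuous continuous_const
  rcases hπ.2 S hcl (fun a v hv => by
    rw [(hmem v).mp hv a]; exact S.zero_mem) with h | h
  · have : v ∈ S := (hmem v).mpr hv
    rwa [h] at this
  · obtain ⟨a, ha⟩ := hπ.1
    refine absurd ?_ ha
    ext w
    exact (hmem w).mp (h ▸ Submodule.mem_top) a

/-- A density theorem of Kadison transitivity type. -/
lemma IsIrreducibleRep.exists_tendsto (hπ : IsIrreducibleRep π) {m : ℕ} {e : Fin m → H}
    (he : LinearIndependent ℂ e) (y : Fin m → H) :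
    ∃ a : ℕ → A, ∀ i, Tendsto (fun t => π (a t) (e i)) atTop (𝓝 (y i)) := by
  let e' : PiLp 2 (fun _ : Fin m => H) := WithLp.toLp 2 e
  let L : A →ₗ[ℂ] PiLp 2 (fun _ : Fin m => H) :=
    { toFun := fun a => diagAmp m (π a) e'
      map_add' := fun a b => by ext i; simp
      map_smul' := fun c a => by ext i; simp }
  let K := (LinearMap.range L).topologicalClosure
  have hKc : IsClosed (K : Set (PiLp 2 (fun _ : Fin m => H))) :=
    Submodule.isClosed_topologicalClosure _
  have : CompleteSpace K := hKc.completeSpace_coe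
  suffices hK : K = ⊤ by
    have hy : WithLp.toLp 2 y ∈ K := hK ▸ Submodule.mem_top
    obtain ⟨z, hz, hzy⟩ := mem_closure_iff_seq_limit.mp hy
    choose a ha using hz
    refine ⟨a, fun i => ?_⟩
    have h1 : Tendsto (fun t => z t i) atTop (𝓝 (y i)) :=
      ((PiLp.continuous_apply 2 (fun _ : Fin m => H) i).tendsto _).comp hzy
    refine h1.congr fun t => ?_
    rw [← ha t]; rfl
  have hLK : ∀ a, L a ∈ K := fun a => Submodule.le_topologicalClosure _ ⟨a, rfl⟩
  have hDK : ∀ a, ∀ v ∈ K, diagAmp m (π a) v ∈ K := by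
    intro a v hv
    refine map_mem_closure (diagAmp m (π a)).continuous hv ?_
    rintro _ ⟨b, rfl⟩
    refine ⟨a * b, ?_⟩
    ext i
    change π (a * b) (e i) = π a (π b (e i))
    rw [map_mul]; rfl
  have hDK' : ∀ a, ∀ v ∈ Kᗮ, diagAmp m (π a) v ∈ Kᗮ := by
    intro a v hv
    rw [Submodule.mem_orthogonal] at hv ⊢
    intro u hu
    rw [← hv _ (hDK (star a) u hu)]
    simp only [PiLp.inner_apply, diagAmp_apply, map_star, ContinuousLinearMap.star_eq_adjoint,
      ContinuousLinearMap.adjoint_inner_left]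
  let P := K.starProjection
  have hPD : ∀ a v, P (diagAmp m (π a) v) = diagAmp m (π a) (P v) := by
    intro a v
    refine Submodule.eq_starProjection_of_mem_orthogonal (hDK a _ (K.starProjection_apply_mem v)) ?_
    rw [← map_sub]
    exact hDK' a _ (K.sub_starProjection_mem_orthogonal v)
  have hPe : P e' = e' := by
    have : ∀ i, (P e' - e') i = 0 := fun i => hπ.eq_zero_of_forall fun a => by
      have h1 : P (diagAmp m (π a) e') = diagAmp m (π a) e' :=
        Submodule.starProjection_eq_self_iff.mpr (hLK a)
      rw [hPD] at h1
      have h2 := congrArg (fun v : PiLp 2 (fun _ : Fin m => H) => v i) h1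
      simp only [diagAmp_apply] at h2
      simp [h2]
    exact sub_eq_zero.mp (PiLp.ext this)
  have hc : ∀ i j, ∃ c : ℂ, (PiLp.proj 2 (fun _ : Fin m => H) i ∘L P ∘L coordEmb m j :
      H →L[ℂ] H) = c • 1 := by
    intro i j
    refine hπ.exists_eq_smul fun a => ?_
    ext x
    change P (coordEmb m j (π a x)) i = π a (P (coordEmb m j x) i)
    have hcomm : coordEmb m j (π a x) = diagAmp m (π a) (coordEmb m j x) := by
      refine PiLp.ext fun l => ?_
      rw [diagAmp_apply, coordEmb_apply, coordEmb_apply]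
      split_ifs <;> simp
    rw [← diagAmp_apply, ← hPD, hcomm]
  choose c hc using hc
  have hc' : ∀ i j x, P (coordEmb m j x) i = c i j • x := fun i j x =>
    congrArg (fun S : H →L[ℂ] H => S x) (hc i j)
  have hP : ∀ v i, P v i = ∑ j, c i j • v j := by
    intro v i
    conv_lhs => rw [← sum_coordEmb m v]
    simp only [map_sum, WithLp.ofLp_sum, Finset.sum_apply, hc']
  have hδ : ∀ i j, c i j = if i = j then 1 else 0 := by
    intro i
    have h1 : ∑ j, (c i j - if i = j then 1 else 0) • e j = 0 := by
      have := hP e' i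
      rw [hPe] at this
      simp only [sub_smul, Finset.sum_sub_distrib, ite_smul, one_smul, zero_smul,
        Finset.sum_ite_eq, Finset.mem_univ, if_true]
      rw [sub_eq_zero]
      exact this.symm
    intro j
    exact sub_eq_zero.mp (Fintype.linearIndependent_iff.mp he _ h1 j)
  rw [eq_top_iff]
  intro v _
  refine Submodule.starProjection_eq_self_iff.mp (PiLp.ext fun i => ?_)
  change P v i = v i
  rw [hP]
  simp [hδ]

end Irreducible

section RowInequality

open Filter Topology

/-- The operator inequality
`(∑ i, x i * w i)⋆ (∑ i, x i * w i) ≤ n • ∑ k, ∑ i, (x k * w i)⋆ (x k * w i)` for families of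
length `n + 1`, which characterizes algebras of matrices of size at most `n`. -/
def RowInequality (n : ℕ) (D : Type*) [NonUnitalCStarAlgebra D] : Prop :=
  ∀ x w : Fin (n + 1) → D, IsPosElem
    ((n : ℂ) • ∑ k, ∑ i, star (x k * w i) * (x k * w i) -
      star (∑ i, x i * w i) * ∑ i, x i * w i)

variable {D : Type*} [NonUnitalCStarAlgebra D]
  {H : Type*} [NormedAddCommGroup H] [InnerProductSpace ℂ H] [CompleteSpace H]

lemma inner_map_star_mul (π : D →⋆ₙₐ[ℂ] (H →L[ℂ] H)) (b c : D) (v w : H) :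
    inner ℂ v (π (star b * c) w) = inner ℂ (π b v) (π c w) := by
  rw [map_mul, map_star, mul_apply_eq_comp, ContinuousLinearMap.star_eq_adjoint,
    ContinuousLinearMap.adjoint_inner_right]

lemma re_inner_map_star_mul_self (π : D →⋆ₙₐ[ℂ] (H →L[ℂ] H)) (b : D) (v : H) :
    (inner ℂ v (π (star b * b) v)).re = ‖π b v‖ ^ 2 := by
  rw [inner_map_star_mul]
  exact inner_self_eq_norm_sq (𝕜 := ℂ) _

lemma IsPosElem.re_inner_nonneg (π : D →⋆ₙₐ[ℂ] (H →L[ℂ] H)) {a : D} (ha : IsPosElem a) (v : H) :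
    0 ≤ (inner ℂ v (π a v)).re := by
  obtain ⟨b, rfl⟩ := ha
  rw [re_inner_map_star_mul_self]
  positivity

lemma re_inner_map_rowInequality (π : D →⋆ₙₐ[ℂ] (H →L[ℂ] H)) {n : ℕ} (x w : Fin (n + 1) → D)
    (v : H) :
    (inner ℂ v (π ((n : ℂ) • ∑ k, ∑ i, star (x k * w i) * (x k * w i) -
      star (∑ i, x i * w i) * ∑ i, x i * w i) v)).re =
      n * ∑ k, ∑ i, ‖π (x k) (π (w i) v)‖ ^ 2 - ‖∑ i, π (x i) (π (w i) v)‖ ^ 2 := by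
  have h1 : ∀ k i, π (x k) (π (w i) v) = π (x k * w i) v := fun k i => by
    rw [map_mul]; rfl
  have h2 : ∑ i, π (x i * w i) v = π (∑ i, x i * w i) v := by
    rw [map_sum, sum_apply]
  simp only [h1, h2]
  rw [map_sub, sub_apply, inner_sub_right, Complex.sub_re,
    re_inner_map_star_mul_self, map_smul, smul_apply, inner_smul_right,
    ← Complex.ofReal_natCast, Complex.re_ofReal_mul, map_sum, sum_apply, inner_sum, Complex.re_sum]
  congr 2
  refine Finset.sum_congr rfl fun k _ => ?_
  rw [map_sum, sum_apply, inner_sum, Complex.re_sum]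
  exact Finset.sum_congr rfl fun i _ => re_inner_map_star_mul_self _ _ _

lemma exists_linearIndependent_of_not_rank_le {V : Type*} [AddCommGroup V] [Module ℂ V] {n : ℕ}
    (h : ¬ Module.rank ℂ V ≤ n) : ∃ e : Fin (n + 1) → V, LinearIndependent ℂ e := by
  have h2 : ((n + 1 : ℕ) : Cardinal) ≤ Module.rank ℂ V := by
    rw [Nat.cast_succ, ← Cardinal.succ_natCast]
    exact Order.succ_le_of_lt (not_le.mp h)
  obtain ⟨s, hs⟩ := Module.le_rank_iff.mp h2
  exact ⟨s, hs⟩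

/-- Irreducible representations of an algebra satisfying the row inequality have dimension at
most `n`. -/
lemma RowInequality.rank_le {n : ℕ} (hD : RowInequality n D) {π : D →⋆ₙₐ[ℂ] (H →L[ℂ] H)}
    (hπ : IsIrreducibleRep π) : Module.rank ℂ H ≤ n := by
  by_contra hr
  obtain ⟨e, he⟩ := exists_linearIndependent_of_not_rank_le hr
  have ineq : ∀ x w : Fin (n + 1) → D, ‖∑ i, π (x i) (π (w i) (e 0))‖ ^ 2 ≤
      n * ∑ k, ∑ i, ‖π (x k) (π (w i) (e 0))‖ ^ 2 := fun x w => by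
    have := (hD x w).re_inner_nonneg π (e 0)
    rw [re_inner_map_rowInequality] at this
    linarith
  have h1 : LinearIndependent ℂ (fun _ : Fin 1 => e 0) :=
    LinearIndependent.of_subsingleton 0 (he.ne_zero 0)
  choose w hw using fun i : Fin (n + 1) => hπ.exists_tendsto h1 (fun _ => e i)
  replace hw := fun i => hw i 0
  choose x hx using fun k : Fin (n + 1) =>
    hπ.exists_tendsto he (fun j => if k = j then e 0 else 0)
  have h2 : ∀ s, ‖∑ i, π (x i s) (e i)‖ ^ 2 ≤ n * ∑ k, ∑ i, ‖π (x k s) (e i)‖ ^ 2 := by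
    intro s
    refine le_of_tendsto_of_tendsto' (b := atTop (α := ℕ)) ?_ ?_
      (fun t => ineq (fun i => x i s) (fun i => w i t))
    · exact ((tendsto_finsetSum _ fun i _ => ((π (x i s)).continuous.tendsto _).comp
        (hw i)).norm).pow 2
    · exact (tendsto_finsetSum _ fun k _ => tendsto_finsetSum _ fun i _ =>
        (((π (x k s)).continuous.tendsto _).comp (hw i)).norm.pow 2).const_mul _
  have h3 : ‖∑ i : Fin (n + 1), e 0‖ ^ 2 ≤
      n * ∑ k : Fin (n + 1), ∑ i, ‖if k = i then e 0 else 0‖ ^ 2 := by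
    refine le_of_tendsto_of_tendsto' (b := atTop (α := ℕ)) ?_ ?_ h2
    · refine ((tendsto_finsetSum _ fun i _ => ?_).norm).pow 2
      simpa using hx i i
    · exact (tendsto_finsetSum _ fun k _ => tendsto_finsetSum _ fun i _ =>
        (hx k i).norm.pow 2).const_mul _
  have h4 : ∀ k : Fin (n + 1), ∑ i, ‖if k = i then e 0 else 0‖ ^ 2 = ‖e 0‖ ^ 2 := fun k => by
    rw [Finset.sum_eq_single k] <;> simp +contextual [eq_comm]
  simp only [h4, Finset.sum_const, Finset.card_univ, Fintype.card_fin, nsmul_eq_mul,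
    ← Nat.cast_smul_eq_nsmul ℂ, norm_smul, mul_pow] at h3
  have h5 : 0 < ‖e 0‖ ^ 2 := by
    have := norm_pos_iff.mpr (he.ne_zero 0)
    positivity
  simp at h3
  norm_cast at h3
  push_cast at h3
  nlinarith

end RowInequality

section TestMaps

open Filter Topology
open scoped ComplexOrder

lemma norm_sum_smul_sq {ι H : Type*} [Fintype ι] [NormedAddCommGroup H] [InnerProductSpace ℂ H]
    (z : ι → ℂ) (v : ι → H) :
    ((‖∑ i, z i • v i‖ ^ 2 : ℝ) : ℂ) = ∑ i, ∑ j, star (z i) * z j * inner ℂ (v i) (v j) := by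
  push_cast
  rw [← Complex.coe_algebraMap, ← inner_self_eq_norm_sq_to_K (𝕜 := ℂ), sum_inner]
  simp only [inner_sum, inner_smul_left, inner_smul_right, RCLike.star_def, mul_assoc]
  refine Finset.sum_congr rfl fun p _ => Finset.sum_congr rfl fun q _ => ?_
  ring

lemma posSemidef_rowMatrix {n : ℕ} {H : Type*} [NormedAddCommGroup H] [InnerProductSpace ℂ H]
    (y : Fin (n + 1) → Fin n → H) :
    (Matrix.of fun P Q : Fin n × Fin (n + 1) =>
      (if P.2 = Q.2 then (n : ℂ) * ∑ k, inner ℂ (y k P.1) (y k Q.1) else 0) -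
        inner ℂ (y P.2 P.1) (y Q.2 Q.1)).PosSemidef := by
  refine Matrix.PosSemidef.of_dotProduct_mulVec_nonneg ?_ fun w => ?_
  · ext P Q
    simp only [Matrix.conjTranspose_apply, Matrix.of_apply, star_sub, RCLike.star_def,
      inner_conj_symm, eq_comm (a := Q.2)]
    split_ifs <;> simp
  let u : Fin (n + 1) → Fin n → ℂ := fun i p => w (p, i)
  let x : Fin (n + 1) → (Fin n → ℂ) →ₗ[ℂ] H := fun k => Fintype.linearCombination ℂ (y k)
  have hx : ∀ k i, x k (u i) = ∑ p, w (p, i) • y k p := fun k i => rfl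
  have ineq := norm_sum_apply_sq_le (n := n) (by simp) u x
  have hsum : ∑ i, x i (u i) = ∑ P : Fin n × Fin (n + 1), w P • y P.2 P.1 := by
    simp only [Fintype.sum_prod_type_right, hx]
  have key : star w ⬝ᵥ (Matrix.of fun P Q : Fin n × Fin (n + 1) =>
      (if P.2 = Q.2 then (n : ℂ) * ∑ k, inner ℂ (y k P.1) (y k Q.1) else 0) -
        inner ℂ (y P.2 P.1) (y Q.2 Q.1)).mulVec w =
      ((n * ∑ k, ∑ i, ‖x k (u i)‖ ^ 2 - ‖∑ i, x i (u i)‖ ^ 2 : ℝ) : ℂ) := by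
    rw [Complex.ofReal_sub, hsum, norm_sum_smul_sq, Complex.ofReal_mul, Complex.ofReal_sum]
    simp only [Complex.ofReal_sum, hx, norm_sum_smul_sq, dotProduct, Matrix.mulVec,
      Matrix.of_apply, sub_mul, Finset.sum_sub_distrib, mul_sub, Finset.mul_sum]
    congr 1
    · simp only [Fintype.sum_prod_type_right, Pi.star_apply, ite_mul, mul_ite, zero_mul, mul_zero,
        Finset.sum_mul, Finset.mul_sum, Finset.sum_ite_irrel, Finset.sum_const_zero,
        Finset.sum_ite_eq, Finset.mem_univ, if_true]
      conv_rhs => rw [Finset.sum_comm]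
      refine Finset.sum_congr rfl fun i _ => ?_
      conv_rhs => rw [Finset.sum_comm]
      refine Finset.sum_congr rfl fun p _ => ?_
      conv_rhs => rw [Finset.sum_comm]
      refine Finset.sum_congr rfl fun q _ => Finset.sum_congr rfl fun k _ => ?_
      push_cast
      ring
    · refine Finset.sum_congr rfl fun P _ => Finset.sum_congr rfl fun Q _ => ?_
      simp only [Pi.star_apply]
      ring
  rw [key]
  exact_mod_cast sub_nonneg.mpr ineq

variable {A : Type*} [NonUnitalCStarAlgebra A]
  {H : Type*} [NormedAddCommGroup H] [InnerProductSpace ℂ H] [CompleteSpace H]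

/-- Coefficient functionals of `testMap`. -/
def testFunctional (n : ℕ) (π : A →⋆ₙₐ[ℂ] (H →L[ℂ] H)) (e : Fin (n + 1) → H)
    (i j : Fin (n + 1)) : A →ₗ[ℂ] ℂ where
  toFun x := (if i = j then (n : ℂ) * ∑ k, inner ℂ (e k) (π x (e k)) else 0) -
    inner ℂ (e i) (π x (e j))
  map_add' x y := by
    simp only [map_add, add_apply, inner_add_right, Finset.sum_add_distrib, mul_add]
    split_ifs <;> ring
  map_smul' c x := by
    simp only [map_smul, smul_apply, inner_smul_right, ← Finset.mul_sum, smul_eq_mul,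
      RingHom.id_apply]
    split_ifs <;> ring

/-- An `n`-positive map attached to a finite family of vectors in a representation. -/
def testMap (n : ℕ) (π : A →⋆ₙₐ[ℂ] (H →L[ℂ] H)) (e : Fin (n + 1) → H) (a : Fin (n + 1) → A) :
    A →ₗ[ℂ] A :=
  ∑ i, ∑ j, (testFunctional n π e i j).smulRight (star (a i) * a j)

lemma testMap_apply (n : ℕ) (π : A →⋆ₙₐ[ℂ] (H →L[ℂ] H)) (e : Fin (n + 1) → H)
    (a : Fin (n + 1) → A) (x : A) :
    testMap n π e a x = ∑ i, ∑ j, testFunctional n π e i j x • (star (a i) * a j) := by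
  simp [testMap]

lemma testFunctional_star_mul (n : ℕ) (π : A →⋆ₙₐ[ℂ] (H →L[ℂ] H)) (e : Fin (n + 1) → H)
    (i j : Fin (n + 1)) (b c : A) :
    testFunctional n π e i j (star b * c) =
      (if i = j then (n : ℂ) * ∑ k, inner ℂ (π b (e k)) (π c (e k)) else 0) -
        inner ℂ (π b (e i)) (π c (e j)) := by
  simp only [testFunctional, LinearMap.coe_mk, AddHom.coe_mk, inner_map_star_mul]

lemma kPositive_testMap (n : ℕ) (π : A →⋆ₙₐ[ℂ] (H →L[ℂ] H)) (e : Fin (n + 1) → H)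
    (a : Fin (n + 1) → A) : KPositive n (testMap n π e a) := by
  intro X hX
  obtain ⟨b, hb⟩ := hX.exists_gram
  let Z : Matrix (Fin n × Fin (n + 1)) (Fin n × Fin (n + 1)) ℂ :=
    Matrix.of fun P Q => testFunctional n π e P.2 Q.2 (X P.1 Q.1)
  have hZ : Z = ∑ r, (Matrix.of fun P Q : Fin n × Fin (n + 1) =>
      (if P.2 = Q.2 then (n : ℂ) * ∑ k, inner ℂ (π (b r P.1) (e k)) (π (b r Q.1) (e k)) else 0) -
        inner ℂ (π (b r P.1) (e P.2)) (π (b r Q.1) (e Q.2))) := by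
    ext P Q
    simp only [Z, Matrix.of_apply, hb, map_sum, testFunctional_star_mul, Matrix.sum_apply]
  have hZpos : Z.PosSemidef := by
    rw [hZ]
    exact Matrix.posSemidef_sum _ fun r _ =>
      posSemidef_rowMatrix fun k p => π (b r p) (e k)
  obtain ⟨N, v, hG⟩ := Matrix.posSemidef_iff_eq_sum_vecMulVec.mp hZpos
  let G : Fin N → Fin n × Fin (n + 1) → ℂ := fun s P => star (v s P)
  have key : X.map (testMap n π e a) = Matrix.of fun p q =>
      ∑ s, star (∑ i, G s (p, i) • a i) * ∑ j, G s (q, j) • a j := by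
    ext p q
    have h1 : ∀ i j, testFunctional n π e i j (X p q) = ∑ s, star (G s (p, i)) * G s (q, j) := by
      intro i j
      have := congrFun (congrFun hG (p, i)) (q, j)
      simpa [Z, Matrix.sum_apply, Matrix.vecMulVec_apply, G] using this
    simp only [Matrix.map_apply, testMap_apply, h1, Matrix.of_apply, star_sum, star_smul,
      Finset.sum_mul_sum, smul_mul_smul_comm, Finset.sum_smul]
    conv_rhs => rw [Finset.sum_comm]
    refine Finset.sum_congr rfl fun i _ => ?_
    conv_rhs => rw [Finset.sum_comm]
  rw [key]
  exact isPosElem_gram _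

lemma re_sum_testMap_nonneg {n : ℕ}
    (h : ∀ φ : A →ₗ[ℂ] A, KPositive n φ → KPositive (n + 1) φ) (π : A →⋆ₙₐ[ℂ] (H →L[ℂ] H))
    (e : Fin (n + 1) → H) (a : Fin (n + 1) → A) :
    0 ≤ (∑ p, ∑ q, ∑ i, ∑ j,
      ((if i = j then (n : ℂ) * ∑ k, inner ℂ (π (a p) (e k)) (π (a q) (e k)) else 0) -
        inner ℂ (π (a p) (e i)) (π (a q) (e j))) *
          inner ℂ (π (a i) (e p)) (π (a j) (e q))).re := by
  have h1 := h _ (kPositive_testMap n π e a) _ (isPosElem_gram fun (_ : Unit) => a)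
  obtain ⟨d, hd⟩ := h1.exists_gram
  have h2 : (∑ r, (‖∑ q, π (d r q) (e q)‖ ^ 2 : ℝ) : ℂ) = ∑ p, ∑ q, ∑ i, ∑ j,
      ((if i = j then (n : ℂ) * ∑ k, inner ℂ (π (a p) (e k)) (π (a q) (e k)) else 0) -
        inner ℂ (π (a p) (e i)) (π (a q) (e j))) *
          inner ℂ (π (a i) (e p)) (π (a j) (e q)) := by
    calc (∑ r, (‖∑ q, π (d r q) (e q)‖ ^ 2 : ℝ) : ℂ)
        = ∑ p, ∑ q, inner ℂ (e p) (π (∑ r, star (d r p) * d r q) (e q)) := by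
          have : ∀ r, ((‖∑ q, π (d r q) (e q)‖ ^ 2 : ℝ) : ℂ) =
              ∑ p, ∑ q, inner ℂ (e p) (π (star (d r p) * d r q) (e q)) := fun r => by
            simp only [inner_map_star_mul]
            simpa using norm_sum_smul_sq 1 fun q => π (d r q) (e q)
          simp only [this, map_sum, sum_apply, inner_sum]
          rw [Finset.sum_comm]
          exact Finset.sum_congr rfl fun p _ => Finset.sum_comm
      _ = _ := by
          refine Finset.sum_congr rfl fun p _ => Finset.sum_congr rfl fun q _ => ?_
          rw [← hd]
          simp only [Matrix.map_apply, Matrix.of_apply, Finset.univ_unique, Finset.sum_singleton,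
            testMap_apply, testFunctional_star_mul, map_sum, sum_apply, inner_sum, map_smul,
            smul_apply, inner_smul_right, inner_map_star_mul]
  rw [← h2]
  norm_cast
  positivity

/-- If every `n`-positive map `A → A` is `(n + 1)`-positive, then irreducible representations
of `A` have dimension at most `n`. -/
theorem rank_le_of_kPositive_imp {n : ℕ}
    (h : ∀ φ : A →ₗ[ℂ] A, KPositive n φ → KPositive (n + 1) φ) {π : A →⋆ₙₐ[ℂ] (H →L[ℂ] H)}
    (hπ : IsIrreducibleRep π) : Module.rank ℂ H ≤ n := by
  by_contra hr
  obtain ⟨e, he⟩ := exists_linearIndependent_of_not_rank_le hr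
  choose a ha using fun k : Fin (n + 1) =>
    hπ.exists_tendsto he (fun j => if k = j then e 0 else 0)
  have hin : ∀ p i q j, Tendsto (fun t => inner ℂ (π (a p t) (e i)) (π (a q t) (e j))) atTop
      (𝓝 ((if p = i then 1 else 0) * (if q = j then 1 else 0) * inner ℂ (e 0) (e 0))) := by
    intro p i q j
    refine ((ha p i).inner (ha q j)).congr' .rfl |>.trans_eq ?_
    split_ifs <;> simp
  have hlim : Tendsto (fun t => ∑ p, ∑ q, ∑ i, ∑ j,
      ((if i = j then (n : ℂ) * ∑ k, inner ℂ (π (a p t) (e k)) (π (a q t) (e k)) else 0) -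
        inner ℂ (π (a p t) (e i)) (π (a q t) (e j))) *
          inner ℂ (π (a i t) (e p)) (π (a j t) (e q))) atTop
      (𝓝 (∑ p : Fin (n + 1), ∑ q : Fin (n + 1), ∑ i : Fin (n + 1), ∑ j : Fin (n + 1),
        ((if i = j then (n : ℂ) * ∑ k : Fin (n + 1),
            ((if p = k then 1 else 0) * (if q = k then 1 else 0) * inner ℂ (e 0) (e 0)) else 0) -
          ((if p = i then 1 else 0) * (if q = j then 1 else 0) * inner ℂ (e 0) (e 0))) *
          ((if i = p then 1 else 0) * (if j = q then 1 else 0) * inner ℂ (e 0) (e 0)))) := by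
    refine tendsto_finsetSum _ fun p _ => tendsto_finsetSum _ fun q _ => tendsto_finsetSum _
      fun i _ => tendsto_finsetSum _ fun j _ => ((Tendsto.sub ?_ (hin p i q j)).mul (hin i p j q))
    split_ifs
    · exact (tendsto_finsetSum _ fun k _ => hin p k q k).const_mul _
    · exact tendsto_const_nhds
  have hge := ge_of_tendsto' ((Complex.continuous_re.tendsto _).comp hlim)
    fun t => re_sum_testMap_nonneg h π e fun p => a p t
  have hpos : 0 < ‖e 0‖ ^ 2 := by
    have := norm_pos_iff.mpr (he.ne_zero 0)
    positivity
  simp only [inner_self_eq_norm_sq_to_K] at hge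
  simp [sub_mul, Finset.sum_sub_distrib, Finset.sum_ite_eq] at hge
  norm_cast at hge
  push_cast at hge
  have hn : (0 : ℝ) < n + 1 := by positivity
  have := mul_pos hn (mul_pos hpos hpos)
  nlinarith

end TestMaps

section PureStates

open Filter Topology
open scoped ComplexOrder

variable {D : Type*} [CStarAlgebra D]

/-- The set of states of a unital C*-algebra, as a set of functions. -/
def stateSet (D : Type*) [CStarAlgebra D] : Set (D → ℂ) :=
  {f | (∀ x y, f (x + y) = f x + f y) ∧ (∀ (c : ℂ) x, f (c • x) = c * f x) ∧ f 1 = 1 ∧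
    ∀ b, 0 ≤ f (star b * b)}

lemma norm_le_of_positive {f : D →ₗ[ℂ] ℂ} (hf : ∀ b, 0 ≤ f (star b * b)) (x : D) :
    ‖f x‖ ≤ 4 * (‖f 1‖ * ‖x‖) := by
  let _ := CStarAlgebra.spectralOrder D
  have _ := CStarAlgebra.spectralOrderedRing D
  let g : D →ₚ[ℂ] ℂ := PositiveLinearMap.mk₀ f fun a ha => by
    obtain ⟨b, rfl⟩ := CStarAlgebra.nonneg_iff_eq_star_mul_self.mp ha
    exact hf b
  obtain ⟨y, hy0, hyn, hy⟩ := CStarAlgebra.exists_sum_four_nonneg x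
  have h1 : f x = ∑ i : Fin 4, Complex.I ^ (i : ℕ) * f (y i) := by
    conv_lhs => rw [hy]
    simp [map_sum, map_smul]
  rw [h1]
  refine (norm_sum_le _ _).trans ?_
  refine (Finset.sum_le_card_nsmul _ _ (‖f 1‖ * ‖x‖) fun i _ => ?_).trans (by simp)
  rw [norm_mul, norm_pow, Complex.norm_I, one_pow, one_mul]
  exact (PositiveLinearMap.norm_apply_le_of_nonneg g (y i) (hy0 i)).trans
    (mul_le_mul_of_nonneg_left (hyn i) (norm_nonneg _))

/-- A member of the state set as a linear functional. -/
def stateSet.toLinearMap {f : D → ℂ} (hf : f ∈ stateSet D) : D →ₗ[ℂ] ℂ where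
  toFun := f
  map_add' := hf.1
  map_smul' := hf.2.1

lemma LinearMap.mem_stateSet {f : D →ₗ[ℂ] ℂ} (h1 : f 1 = 1) (hf : ∀ b, 0 ≤ f (star b * b)) :
    ⇑f ∈ stateSet D :=
  ⟨map_add f, map_smul f, h1, hf⟩

lemma isCompact_stateSet : IsCompact (stateSet D) := by
  refine IsCompact.of_isClosed_subset
    (isCompact_univ_pi fun x : D => isCompact_closedBall (0 : ℂ) (4 * ‖x‖)) ?_ ?_
  · have : stateSet D = (⋂ x, ⋂ y, {f | f (x + y) = f x + f y}) ∩
        ((⋂ c : ℂ, ⋂ x, {f | f (c • x) = c * f x}) ∩ ({f | f 1 = 1} ∩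
          ⋂ b, {f | 0 ≤ f (star b * b)})) := by
      ext f
      simp [stateSet]
    rw [this]
    refine (isClosed_iInter fun x => isClosed_iInter fun y => isClosed_eq ?_ ?_).inter
      ((isClosed_iInter fun c => isClosed_iInter fun x => isClosed_eq ?_ ?_).inter
        ((isClosed_eq ?_ ?_).inter (isClosed_iInter fun b => isClosed_le ?_ ?_))) <;> fun_prop
  · intro f hf x _
    have := norm_le_of_positive (f := stateSet.toLinearMap hf) hf.2.2.2 x
    have h1 : ‖stateSet.toLinearMap hf 1‖ = 1 := by
      change ‖f 1‖ = 1
      rw [hf.2.2.1, norm_one]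
    rw [h1, one_mul] at this
    rw [mem_closedBall_zero_iff]
    exact this

lemma convex_stateSet : Convex ℝ (stateSet D) := by
  intro f hf g hg a b ha hb hab
  have hab' : (a : ℂ) + b = 1 := by exact_mod_cast hab
  refine ⟨fun x y => ?_, fun c x => ?_, ?_, fun y => ?_⟩
  · simp only [Pi.add_apply, Pi.smul_apply, hf.1, hg.1, smul_add]
    ring
  · simp only [Pi.add_apply, Pi.smul_apply, hf.2.1, hg.2.1, Complex.real_smul]
    ring
  · simp [hf.2.2.1, hg.2.2.1, hab']
  · have h1 : (0 : ℂ) ≤ a := by exact_mod_cast ha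
    have h2 : (0 : ℂ) ≤ b := by exact_mod_cast hb
    simp only [Pi.add_apply, Pi.smul_apply, Complex.real_smul]
    exact add_nonneg (mul_nonneg h1 (hf.2.2.2 y)) (mul_nonneg h2 (hg.2.2.2 y))

lemma exists_extreme_state_neg {h : D} (hh : star h = h) (hn : ¬ IsPosElem h) :
    ∃ f ∈ (stateSet D).extremePoints ℝ, (f h).re < 0 := by
  obtain ⟨ω, hω, hωh⟩ := exists_positive_functional_neg hh hn
  have h1 : 0 ≤ ω 1 := by simpa using hω 1
  have hne : ω 1 ≠ 0 := by
    intro h0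
    have := norm_le_of_positive hω h
    rw [h0, norm_zero, zero_mul, mul_zero, norm_le_zero_iff] at this
    rw [this] at hωh
    simp at hωh
  have hpos : 0 < ω 1 := lt_of_le_of_ne h1 hne.symm
  obtain ⟨r, hr⟩ : ∃ r : ℝ, ω 1 = r := ⟨(ω 1).re, (Complex.eq_re_of_ofReal_le h1)⟩
  have hr0 : 0 < r := by rw [hr] at hpos; exact_mod_cast hpos
  have hmem : ⇑(((r⁻¹ : ℝ) : ℂ) • ω) ∈ stateSet D := by
    refine LinearMap.mem_stateSet ?_ fun b => ?_
    · simp [hr, hr0.ne']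
    · exact mul_nonneg (by exact_mod_cast (inv_pos.mpr hr0).le) (hω b)
  by_contra! hcon
  have hclosed : IsClosed {f : D → ℂ | 0 ≤ (f h).re} :=
    isClosed_le continuous_const (Complex.continuous_re.comp (continuous_apply h))
  have hconv : Convex ℝ {f : D → ℂ | 0 ≤ (f h).re} := by
    intro f hf g hg a b ha hb hab
    have hf' : 0 ≤ (f h).re := hf
    have hg' : 0 ≤ (g h).re := hg
    change 0 ≤ (a • f h + b • g h).re
    simp
    positivity
  have hsub := closure_minimal (convexHull_min hcon hconv) hclosed
  rw [closure_convexHull_extremePoints isCompact_stateSet convex_stateSet] at hsub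
  have h2 : 0 ≤ (((r⁻¹ : ℝ) : ℂ) * ω h).re := hsub hmem
  rw [Complex.re_ofReal_mul] at h2
  have := mul_neg_of_pos_of_neg (inv_pos.mpr hr0) hωh
  linarith

variable {H : Type*} [NormedAddCommGroup H] [InnerProductSpace ℂ H] [CompleteSpace H]

lemma starProjection_commute {π : D →⋆ₙₐ[ℂ] (H →L[ℂ] H)} {S : Submodule ℂ H} [CompleteSpace S]
    (hS : ∀ a, ∀ v ∈ S, π a v ∈ S) (a : D) (v : H) :
    S.starProjection (π a v) = π a (S.starProjection v) := by
  refine Submodule.eq_starProjection_of_mem_orthogonal (hS a _ (S.starProjection_apply_mem v)) ?_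
  rw [← map_sub, Submodule.mem_orthogonal]
  intro u hu
  rw [← ContinuousLinearMap.adjoint_inner_left, ← ContinuousLinearMap.star_eq_adjoint, ← map_star]
  exact (Submodule.mem_orthogonal _ _).mp (S.sub_starProjection_mem_orthogonal v) _
    (hS (star a) u hu)

/-- The functional of a vector in a representation. -/
def vectorFunctional (π : D →⋆ₙₐ[ℂ] (H →L[ℂ] H)) (v : H) : D →ₗ[ℂ] ℂ where
  toFun a := inner ℂ v (π a v)
  map_add' a b := by simp
  map_smul' c a := by simp

lemma vectorFunctional_apply (π : D →⋆ₙₐ[ℂ] (H →L[ℂ] H)) (v : H) (a : D) :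
    vectorFunctional π v a = inner ℂ v (π a v) := rfl

lemma vectorFunctional_mem_stateSet {π : D →⋆ₙₐ[ℂ] (H →L[ℂ] H)} (hπ1 : π 1 = 1) {v : H}
    (hv : v ≠ 0) : ⇑((((‖v‖ ^ 2)⁻¹ : ℝ) : ℂ) • vectorFunctional π v) ∈ stateSet D := by
  have h0 : ‖v‖ ≠ 0 := norm_ne_zero_iff.mpr hv
  refine LinearMap.mem_stateSet ?_ fun b => ?_
  · rw [LinearMap.smul_apply, vectorFunctional_apply, hπ1, one_apply_eq_self,
      inner_self_eq_norm_sq_to_K, smul_eq_mul]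
    simp [h0]
  · refine mul_nonneg (by norm_cast; positivity) ?_
    rw [vectorFunctional_apply, inner_map_star_mul, inner_self_eq_norm_sq_to_K]
    norm_cast
    positivity

lemma isIrreducibleRep_of_extreme {π : D →⋆ₙₐ[ℂ] (H →L[ℂ] H)} (hπ1 : π 1 = 1) {ξ : H}
    (hξ : ‖ξ‖ = 1) (hcyc : DenseRange fun a => π a ξ)
    (hext : ⇑(vectorFunctional π ξ) ∈ (stateSet D).extremePoints ℝ) : IsIrreducibleRep π := by
  have hξ0 : ξ ≠ 0 := by rintro rfl; simp at hξ
  refine ⟨⟨1, fun h => hξ0 ?_⟩, fun S hSc hS => ?_⟩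
  · have := congrArg (fun T : H →L[ℂ] H => T ξ) (hπ1.symm.trans h)
    simpa using this
  have : CompleteSpace S := hSc.completeSpace_coe
  have hcomm := starProjection_commute (π := π) hS
  let P := S.starProjection
  have ext_of_cyclic : ∀ T : H →L[ℂ] H, (∀ a, P (π a ξ) = T (π a ξ)) → P = T := by
    intro T h
    ext v
    exact congrFun (hcyc.equalizer P.continuous T.continuous (funext h)) v
  by_cases h0 : P ξ = 0
  · left
    have hP : P = 0 := ext_of_cyclic 0 fun a => by
      rw [hcomm]; change π a (P ξ) = _; rw [h0]; simp
    rw [eq_bot_iff]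
    intro v hv
    have := Submodule.starProjection_eq_self_iff.mpr hv
    change P v = v at this
    rw [hP] at this
    exact this.symm
  by_cases h1 : ξ - P ξ = 0
  · right
    have hP : P = 1 := ext_of_cyclic 1 fun a => by
      rw [hcomm]; change π a (P ξ) = _; rw [← sub_eq_zero.mp h1]; rfl
    rw [eq_top_iff]
    intro v _
    refine Submodule.starProjection_eq_self_iff.mp ?_
    change P v = v
    rw [hP]; rfl
  exfalso
  have horth : ∀ u v, inner ℂ (P u) (v - P v) = 0 := fun u v =>
    (Submodule.mem_orthogonal _ _).mp (S.sub_starProjection_mem_orthogonal v) _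
      (S.starProjection_apply_mem u)
  have horth' : ∀ u v, inner ℂ (v - P v) (P u) = 0 := fun u v => by
    rw [← inner_conj_symm, horth, map_zero]
  have hs1 : ‖P ξ‖ ^ 2 + ‖ξ - P ξ‖ ^ 2 = 1 := by
    have := norm_add_sq_eq_norm_sq_add_norm_sq_of_inner_eq_zero _ _ (horth ξ ξ)
    rw [add_sub_cancel, hξ] at this
    nlinarith
  have hsum : ∀ a, vectorFunctional π ξ a =
      vectorFunctional π (P ξ) a + vectorFunctional π (ξ - P ξ) a := by
    intro a
    simp only [vectorFunctional_apply]
    have e1 : π a (P ξ) = P (π a ξ) := (hcomm a ξ).symm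
    have e2 : π a (ξ - P ξ) = π a ξ - P (π a ξ) := by rw [map_sub, e1]
    rw [e1, e2]
    have e3 : inner ℂ ξ (π a ξ) = inner ℂ (P ξ + (ξ - P ξ)) (P (π a ξ) + (π a ξ - P (π a ξ))) := by
      simp
    rw [e3, inner_add_left, inner_add_right, inner_add_right, horth, horth']
    ring
  have hp0 : 0 < ‖P ξ‖ ^ 2 := by
    have := norm_pos_iff.mpr h0; positivity
  have hq0 : 0 < ‖ξ - P ξ‖ ^ 2 := by
    have := norm_pos_iff.mpr h1; positivity
  have hE := (mem_extremePoints.mp hext).2 _ (vectorFunctional_mem_stateSet hπ1 h0) _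
    (vectorFunctional_mem_stateSet hπ1 h1) ⟨‖P ξ‖ ^ 2, ‖ξ - P ξ‖ ^ 2, hp0, hq0, hs1, by
      ext a
      rw [hsum]
      have e1 : (‖P ξ‖ : ℂ) ≠ 0 := by exact_mod_cast (norm_ne_zero_iff.mpr h0)
      have e2 : (‖ξ - P ξ‖ : ℂ) ≠ 0 := by exact_mod_cast (norm_ne_zero_iff.mpr h1)
      simp only [Pi.add_apply, Pi.smul_apply, LinearMap.smul_apply, smul_eq_mul,
        Complex.real_smul]
      push_cast
      field_simp⟩
  have hval : ∀ a, inner ℂ ξ (P (π a ξ)) = ((‖P ξ‖ ^ 2 : ℝ) : ℂ) * inner ℂ ξ (π a ξ) := by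
    intro a
    have h2 := congrFun hE.1 a
    have e1 : (‖P ξ‖ : ℂ) ≠ 0 := by exact_mod_cast (norm_ne_zero_iff.mpr h0)
    simp only [LinearMap.smul_apply, smul_eq_mul, vectorFunctional_apply] at h2
    rw [← h2, ← mul_assoc]
    have e3 : π a (P ξ) = P (π a ξ) := (hcomm a ξ).symm
    have e4 : inner ℂ ξ (P (π a ξ)) = inner ℂ (P ξ + (ξ - P ξ)) (P (π a ξ)) := by simp
    rw [e3, e4, inner_add_left, horth']
    push_cast
    field_simp
    simp
  have hPs : P = ((‖P ξ‖ ^ 2 : ℝ) : ℂ) • (1 : H →L[ℂ] H) := ext_of_cyclic _ fun a => by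
    rw [← sub_eq_zero]
    refine hcyc.eq_zero_of_inner_right (𝕜 := ℂ) ?_
    intro b
    have e1 := hval (star b * a)
    have e2 : P (π (star b * a) ξ) = π (star b) (P (π a ξ)) := by
      rw [map_mul]; exact hcomm (star b) (π a ξ)
    rw [e2, map_mul, map_star, ContinuousLinearMap.star_eq_adjoint, mul_apply_eq_comp,
      ContinuousLinearMap.adjoint_inner_right, ContinuousLinearMap.adjoint_inner_right] at e1
    rw [inner_sub_right, e1]
    simp [inner_smul_right]
  have h3 : P (P ξ) = P ξ := Submodule.starProjection_eq_self_iff.mpr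
    (S.starProjection_apply_mem ξ)
  have h4 : P (P ξ) = ((‖P ξ‖ ^ 2 : ℝ) : ℂ) • P ξ :=
    (congrArg (fun T : H →L[ℂ] H => T (P ξ)) hPs).trans (by simp)
  rw [h3] at h4
  have h5 : (1 - ((‖P ξ‖ ^ 2 : ℝ) : ℂ)) • P ξ = 0 := by
    rw [sub_smul, one_smul, ← h4, sub_self]
  rcases smul_eq_zero.mp h5 with h6 | h6
  · have : 1 - ‖P ξ‖ ^ 2 = 0 := by exact_mod_cast h6
    linarith
  · exact h0 h6

/-- Irreducible representations detect positivity. -/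
lemma exists_irreducible_inner_neg {D : Type} [CStarAlgebra D] {h : D} (hh : star h = h)
    (hn : ¬ IsPosElem h) :
    ∃ (H : Type) (_ : NormedAddCommGroup H) (_ : InnerProductSpace ℂ H) (_ : CompleteSpace H)
      (π : D →⋆ₙₐ[ℂ] (H →L[ℂ] H)) (v : H),
      IsIrreducibleRep π ∧ (inner ℂ v (π h v)).re < 0 := by
  obtain ⟨f, hf, hfh⟩ := exists_extreme_state_neg hh hn
  let _ := CStarAlgebra.spectralOrder D
  have _ := CStarAlgebra.spectralOrderedRing D
  let g : D →ₚ[ℂ] ℂ := PositiveLinearMap.mk₀ (stateSet.toLinearMap hf.1) fun a ha => by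
    obtain ⟨b, rfl⟩ := CStarAlgebra.nonneg_iff_eq_star_mul_self.mp ha
    exact hf.1.2.2.2 b
  let ξ : g.GNS := ((g.toPreGNS 1 : g.PreGNS) : g.GNS)
  have hπξ : ∀ a, g.gnsNonUnitalStarAlgHom a ξ = ((g.toPreGNS a : g.PreGNS) : g.GNS) := by
    intro a
    simp [ξ]
  have hvec : ⇑(vectorFunctional g.gnsNonUnitalStarAlgHom ξ) = f := by
    ext a
    rw [vectorFunctional_apply, hπξ, UniformSpace.Completion.inner_coe, g.preGNS_inner_def]
    simp only [PositiveLinearMap.ofPreGNS_toPreGNS, star_one, one_mul]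
    rfl
  refine ⟨g.GNS, inferInstance, inferInstance, inferInstance, g.gnsNonUnitalStarAlgHom, ξ,
    isIrreducibleRep_of_extreme (ξ := ξ) ?_ ?_ ?_ ?_, ?_⟩
  · exact map_one g.gnsStarAlgHom
  · have h1 := congrFun hvec 1
    rw [hf.1.2.2.1, vectorFunctional_apply, hπξ] at h1
    change inner ℂ ξ ξ = (1 : ℂ) at h1
    rw [inner_self_eq_norm_sq_to_K] at h1
    have h2 : ‖ξ‖ ^ 2 = 1 := Complex.ofReal_injective (by simpa using h1)
    exact (pow_eq_one_iff_of_nonneg (norm_nonneg ξ) two_ne_zero).mp h2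
  · have : (fun a => g.gnsNonUnitalStarAlgHom a ξ) =
        fun a => ((g.toPreGNS a : g.PreGNS) : g.GNS) := funext hπξ
    rw [this]
    exact UniformSpace.Completion.denseRange_coe.comp g.toPreGNS.surjective.denseRange
      (UniformSpace.Completion.continuous_coe _)
  · rw [hvec]; exact hf
  · rw [← vectorFunctional_apply, hvec]; exact hfh

end PureStates

section SubhomogeneousRow

open scoped ComplexOrder

lemma IsPosElem.of_inr {A : Type*} [NonUnitalCStarAlgebra A] {h : A}
    (hp : IsPosElem (h : Unitization ℂ A)) : IsPosElem h := by
  let _ := CStarAlgebra.spectralOrder A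
  have _ := CStarAlgebra.spectralOrderedRing A
  let _ := CStarAlgebra.spectralOrder (Unitization ℂ A)
  have _ := CStarAlgebra.spectralOrderedRing (Unitization ℂ A)
  rw [isPosElem_iff_nonneg] at hp ⊢
  exact Unitization.inr_nonneg_iff.mp hp

/-- An irreducible representation of the unitization which does not vanish on `A` restricts to an
irreducible representation of `A`. -/
lemma IsIrreducibleRep.comp_inr {A : Type*} [NonUnitalCStarAlgebra A] {H : Type*}
    [NormedAddCommGroup H] [InnerProductSpace ℂ H] [CompleteSpace H]
    {π : Unitization ℂ A →⋆ₙₐ[ℂ] (H →L[ℂ] H)} (hπ : IsIrreducibleRep π)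
    (h0 : ∃ a : A, π a ≠ 0) :
    IsIrreducibleRep (π.comp (Unitization.inrNonUnitalStarAlgHom ℂ A)) := by
  refine ⟨h0, fun S hSc hS => hπ.2 S hSc fun z v hv => ?_⟩
  obtain ⟨c, hc⟩ := hπ.exists_eq_smul (T := π 1) fun a => by
    rw [Commute, SemiconjBy, ← map_mul, ← map_mul, one_mul, mul_one]
  have hz : z = z.fst • (1 : Unitization ℂ A) + (z.snd : Unitization ℂ A) := by
    ext <;> simp
  rw [hz, map_add, map_smul, hc]
  exact S.add_mem (S.smul_mem _ (S.smul_mem _ hv)) (hS z.snd v hv)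

lemma star_rowElement {D : Type*} [NonUnitalCStarAlgebra D] (n : ℕ) (x w : Fin (n + 1) → D) :
    star ((n : ℂ) • ∑ k, ∑ i, star (x k * w i) * (x k * w i) -
      star (∑ i, x i * w i) * ∑ i, x i * w i) =
    (n : ℂ) • ∑ k, ∑ i, star (x k * w i) * (x k * w i) -
      star (∑ i, x i * w i) * ∑ i, x i * w i := by
  simp only [star_sub, star_smul, star_sum, star_mul, star_star, star_natCast]

lemma IsSubhomogeneous.rowInequality {A : Type} [NonUnitalCStarAlgebra A] {n : ℕ}
    (hA : IsSubhomogeneous n A) : RowInequality n A := by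
  intro x w
  by_contra hneg
  obtain ⟨H, _, _, _, π, v, hπ, hv⟩ := exists_irreducible_inner_neg
    (h := ((((n : ℂ) • ∑ k, ∑ i, star (x k * w i) * (x k * w i) -
      star (∑ i, x i * w i) * ∑ i, x i * w i : A)) : Unitization ℂ A))
    (by rw [← Unitization.inr_star, star_rowElement]) (fun h => hneg h.of_inr)
  have hσ := hπ.comp_inr ⟨_, fun h => by rw [h] at hv; simp at hv⟩
  have hr := hA H _ hσ
  have hfin : Module.Finite ℂ H :=
    Module.rank_lt_aleph0_iff.mp (hr.trans_lt (Cardinal.natCast_lt_aleph0))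
  have hle : Module.finrank ℂ H ≤ n := by
    rw [← Module.finrank_eq_rank] at hr
    exact_mod_cast hr
  set σ := π.comp (Unitization.inrNonUnitalStarAlgHom ℂ A) with hσd
  have h1 := re_inner_map_rowInequality σ x w v
  have h2 := norm_sum_apply_sq_le hle (fun i => σ (w i) v) (fun i => (σ (x i)).toLinearMap)
  have h3 : (inner ℂ v (σ ((n : ℂ) • ∑ k, ∑ i, star (x k * w i) * (x k * w i) -
      star (∑ i, x i * w i) * ∑ i, x i * w i) v)).re < 0 := hv
  rw [h1] at h3
  simp only [ContinuousLinearMap.coe_coe] at h2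
  linarith

end SubhomogeneousRow

section ColumnPositivity

open scoped ComplexOrder
open Filter Topology

lemma IsIrreducibleRep.exists_apply_eq {A : Type*} [NonUnitalCStarAlgebra A] {H : Type*}
    [NormedAddCommGroup H] [InnerProductSpace ℂ H] [CompleteSpace H] [FiniteDimensional ℂ H]
    {π : A →⋆ₙₐ[ℂ] (H →L[ℂ] H)} (hπ : IsIrreducibleRep π) {v : H} (hv : v ≠ 0) (y : H) :
    ∃ a, π a v = y := by
  let ev : A →ₗ[ℂ] H :=
    { toFun := fun a => π a v
      map_add' := fun a b => by simp
      map_smul' := fun c a => by simp }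
  obtain ⟨a, ha⟩ := hπ.exists_tendsto (e := fun _ : Fin 1 => v)
    (LinearIndependent.of_subsingleton 0 hv) (fun _ => y)
  have hmem : y ∈ LinearMap.range ev :=
    (Submodule.closed_of_finiteDimensional (LinearMap.range ev)).mem_of_tendsto (ha 0)
      (Eventually.of_forall fun t => ⟨a t, rfl⟩)
  exact hmem

lemma exists_fin_spanning {V : Type*} [AddCommGroup V] [Module ℂ V] {n : ℕ}
    (h : Module.rank ℂ V ≤ n) :
    ∃ e : Fin n → V, ∀ v, ∃ c : Fin n → ℂ, v = ∑ p, c p • e p := by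
  have hfin : Module.Finite ℂ V :=
    Module.rank_lt_aleph0_iff.mp (h.trans_lt (Cardinal.natCast_lt_aleph0))
  have hle : Module.finrank ℂ V ≤ n := by
    rw [← Module.finrank_eq_rank] at h
    exact_mod_cast h
  let b := Module.finBasis ℂ V
  obtain ⟨f⟩ : Nonempty (Fin (Module.finrank ℂ V) ↪ Fin n) := ⟨Fin.castLEEmb hle⟩
  refine ⟨Function.extend f b 0, fun v => ⟨Function.extend f (b.repr v) 0, ?_⟩⟩
  rw [← Finset.sum_subset (Finset.subset_univ (Finset.univ.map f)), Finset.sum_map]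
  · simp only [f.injective.extend_apply]
    exact (b.sum_repr v).symm
  · intro p _ hp
    rw [Function.extend_apply' (b.repr v) _ _ fun ⟨q, hq⟩ => hp (by simp [← hq])]
    simp

/-- If all irreducible representations of `D` have dimension at most `n`, then positivity of a
self-adjoint matrix over `D` may be tested on columns spanned by `n` elements. -/
lemma isPosElem_of_forall_span {D : Type} [CStarAlgebra D] {n k : ℕ}
    (hD : RowInequality n D) {T : Matrix (Fin k) (Fin k) D} (hT : star T = T)
    (h : ∀ (R : Fin n → D) (c : Fin n → Fin k → ℂ), IsPosElem
      (∑ p, ∑ q, star (R p) * (∑ i, ∑ j, (star (c p i) * c q j) • T i j) * R q)) :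
    IsPosElem T := by
  refine isPosElem_of_forall_column hT fun S => ?_
  by_contra hneg
  have hstar : star (∑ i, ∑ j, star (S i) * T i j * S j) = ∑ i, ∑ j, star (S i) * T i j * S j := by
    have hTe : ∀ i j, star (T i j) = T j i := fun i j => by
      conv_rhs => rw [← hT]
      rfl
    simp only [star_sum, star_mul, star_star, hTe]
    rw [Finset.sum_comm]
    simp only [mul_assoc]
  obtain ⟨H, _, _, _, π, v, hπ, hv⟩ := exists_irreducible_inner_neg hstar hneg
  have hv0 : v ≠ 0 := by rintro rfl; simp at hv
  have hr := hD.rank_le hπ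
  have hfin : FiniteDimensional ℂ H :=
    Module.rank_lt_aleph0_iff.mp (hr.trans_lt (Cardinal.natCast_lt_aleph0))
  obtain ⟨e, he⟩ := exists_fin_spanning hr
  choose R hR using fun p => hπ.exists_apply_eq hv0 (e p)
  choose c hc using fun i => he (π (S i) v)
  refine absurd ((h R fun p i => c i p).re_inner_nonneg π v) (not_le.mpr ?_)
  refine lt_of_eq_of_lt ?_ hv
  congr 1
  have e1 : ∀ a b t : D, inner ℂ v (π (star a * t * b) v) = inner ℂ (π a v) (π t (π b v)) := by
    intro a b t
    rw [mul_assoc, inner_map_star_mul, map_mul, mul_apply_eq_comp]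
  have e2 : ∀ i j, inner ℂ (π (S i) v) (π (T i j) (π (S j) v)) =
      ∑ p, ∑ q, star (c i p) * c j q * inner ℂ (e p) (π (T i j) (e q)) := by
    intro i j
    rw [hc i, hc j]
    simp only [map_sum, map_smul, sum_inner, inner_sum, inner_smul_left, inner_smul_right,
      Finset.mul_sum, starRingEnd_apply]
    rw [Finset.sum_comm]
    refine Finset.sum_congr rfl fun p _ => Finset.sum_congr rfl fun q _ => ?_
    ring
  simp only [map_sum, sum_apply, inner_sum, e1, e2]
  simp only [hR, map_smul, smul_apply, inner_smul_right]
  rw [Finset.sum_congr rfl fun p _ => Finset.sum_comm]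
  rw [Finset.sum_comm]
  refine Finset.sum_congr rfl fun i _ => ?_
  rw [Finset.sum_congr rfl fun p _ => Finset.sum_comm]
  rw [Finset.sum_comm]

end ColumnPositivity

section DenseForms

variable {E H : Type*} [AddCommGroup E] [Module ℂ E] [NormedAddCommGroup H]
  [InnerProductSpace ℂ H]

/-- A sesquilinear form bounded by a Hilbert seminorm on the diagonal is bounded. -/
lemma norm_sesq_le (Λ : E →ₗ[ℂ] H) (B : E →ₗ⋆[ℂ] E →ₗ[ℂ] ℂ)
    (hB : ∀ x, ‖B x x‖ ≤ ‖Λ x‖ ^ 2) (x y : E) : ‖B x y‖ ≤ 2 * ‖Λ x‖ * ‖Λ y‖ := by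
  have key : ∀ x y, ‖B x y‖ ≤ ‖Λ x‖ ^ 2 + ‖Λ y‖ ^ 2 := by
    intro x y
    have pol : 4 * B x y = B (x + y) (x + y) - B (x - y) (x - y)
        - Complex.I * B (x + Complex.I • y) (x + Complex.I • y)
        + Complex.I * B (x - Complex.I • y) (x - Complex.I • y) := by
      simp only [map_add, map_sub, LinearMap.add_apply, LinearMap.sub_apply, map_smul,
        LinearMap.map_smulₛₗ, LinearMap.smul_apply, smul_eq_mul, Complex.conj_I]
      linear_combination (2 * B x y - 2 * B y x) * Complex.I_sq
    have p1 := parallelogram_law_with_norm ℂ (Λ x) (Λ y)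
    have p2 := parallelogram_law_with_norm ℂ (Λ x) (Complex.I • Λ y)
    have p3 : ‖Complex.I • Λ y‖ = ‖Λ y‖ := by simp [norm_smul]
    rw [p3] at p2
    have h1 : ‖B (x + y) (x + y)‖ ≤ ‖Λ x + Λ y‖ ^ 2 := by rw [← map_add Λ]; exact hB _
    have h2 : ‖B (x - y) (x - y)‖ ≤ ‖Λ x - Λ y‖ ^ 2 := by rw [← map_sub Λ]; exact hB _
    have h3 : ‖B (x + Complex.I • y) (x + Complex.I • y)‖ ≤ ‖Λ x + Complex.I • Λ y‖ ^ 2 := by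
      rw [← map_smul Λ, ← map_add Λ]; exact hB _
    have h4 : ‖B (x - Complex.I • y) (x - Complex.I • y)‖ ≤ ‖Λ x - Complex.I • Λ y‖ ^ 2 := by
      rw [← map_smul Λ, ← map_sub Λ]; exact hB _
    have h5 : ‖4 * B x y‖ ≤ ‖B (x + y) (x + y)‖ + ‖B (x - y) (x - y)‖
        + ‖B (x + Complex.I • y) (x + Complex.I • y)‖
        + ‖B (x - Complex.I • y) (x - Complex.I • y)‖ := by
      rw [pol]
      refine (norm_add_le _ _).trans (add_le_add ((norm_sub_le _ _).trans
        (add_le_add (norm_sub_le _ _) ?_)) ?_) <;> simp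
    rw [norm_mul, Complex.norm_ofNat] at h5
    linarith
  have hd := discrim_le_zero (a := ‖Λ x‖ ^ 2) (b := -‖B x y‖) (c := ‖Λ y‖ ^ 2) fun t => by
    have h1 := key ((t : ℂ) • x) y
    simp only [map_smul, LinearMap.map_smulₛₗ, LinearMap.smul_apply, norm_smul] at h1
    simp at h1
    have h2 := mul_le_mul_of_nonneg_right (le_abs_self t) (norm_nonneg (B x y))
    rw [mul_pow, sq_abs] at h1
    nlinarith
  rw [discrim] at hd
  refine abs_le_of_sq_le_sq' ?_ (by positivity) |>.2
  nlinarith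

/-- The bounded operator associated with a bounded sesquilinear form on a dense subspace. -/
lemma exists_operator_of_sesq [CompleteSpace H] {Λ : E →ₗ[ℂ] H} (hΛ : DenseRange Λ)
    (B : E →ₗ⋆[ℂ] E →ₗ[ℂ] ℂ) {C : ℝ} (hB : ∀ x y, ‖B x y‖ ≤ C * ‖Λ x‖ * ‖Λ y‖) :
    ∃ T : H →L[ℂ] H, ∀ x y, inner ℂ (Λ x) (T (Λ y)) = B x y := by
  let g : E → H := fun x => (InnerProductSpace.toDual ℂ H).symm ((B x).extendOfNorm Λ)
  have hg : ∀ x y, inner ℂ (g x) (Λ y) = B x y := fun x y => by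
    rw [InnerProductSpace.toDual_symm_apply, LinearMap.extendOfNorm_eq hΛ ⟨_, hB x⟩]
  have huniq : ∀ u v : H, (∀ y, inner ℂ u (Λ y) = inner ℂ v (Λ y)) → u = v := fun u v h => by
    rw [← sub_eq_zero]
    refine hΛ.eq_zero_of_inner_left (𝕜 := ℂ) fun y => ?_
    rw [inner_sub_left, h, sub_self]
  let S : E →ₗ[ℂ] H :=
    { toFun := g
      map_add' := fun x x' => huniq _ _ fun y => by
        rw [inner_add_left, hg, hg, hg, map_add, LinearMap.add_apply]
      map_smul' := fun c x => huniq _ _ fun y => by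
        rw [inner_smul_left, hg]
        simp [hg] }
  have hS : ∀ x, ‖S x‖ ≤ C * ‖Λ x‖ := fun x => by
    change ‖(InnerProductSpace.toDual ℂ H).symm ((B x).extendOfNorm Λ)‖ ≤ _
    rw [LinearIsometryEquiv.norm_map]
    have h0 : 0 ≤ C * ‖Λ x‖ ∨ ∀ y, Λ y = 0 := by
      by_contra! h
      obtain ⟨h1, y, hy⟩ := h
      have h2 := (norm_nonneg _).trans (hB x y)
      have h3 := norm_pos_iff.mpr hy
      nlinarith
    rcases h0 with h0 | h0
    · exact LinearMap.opNorm_extendOfNorm_le hΛ h0 (hB x)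
    · rw [show (B x).extendOfNorm Λ = 0 from ContinuousLinearMap.ext fun v => by
        have := huniq v 0 fun y => by simp [h0]
        rw [this, map_zero, map_zero], norm_zero, h0, norm_zero, mul_zero]
  refine ⟨ContinuousLinearMap.adjoint (S.extendOfNorm Λ), fun x y => ?_⟩
  rw [ContinuousLinearMap.adjoint_inner_right, LinearMap.extendOfNorm_eq hΛ ⟨C, hS⟩]
  exact hg x y

end DenseForms

section Commutant

open Filter Topology
open scoped ComplexOrder

variable {A : Type*} [NonUnitalCStarAlgebra A] {H : Type*} [NormedAddCommGroup H]
  [InnerProductSpace ℂ H] [CompleteSpace H]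

/-- The commutant of a representation. -/
abbrev commutant (π : A →⋆ₙₐ[ℂ] (H →L[ℂ] H)) : StarSubalgebra ℂ (H →L[ℂ] H) :=
  StarSubalgebra.centralizer ℂ (Set.range π)

instance isClosed_commutant (π : A →⋆ₙₐ[ℂ] (H →L[ℂ] H)) :
    IsClosed (commutant π : Set (H →L[ℂ] H)) := by
  rw [StarSubalgebra.coe_centralizer]
  exact Set.isClosed_centralizer _

lemma mem_commutant_iff {π : A →⋆ₙₐ[ℂ] (H →L[ℂ] H)} {T : H →L[ℂ] H} :
    T ∈ commutant π ↔ ∀ a, Commute T (π a) := by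
  rw [StarSubalgebra.mem_centralizer_iff]
  constructor
  · exact fun h a => (h _ ⟨a, rfl⟩).1.symm
  · rintro h _ ⟨a, rfl⟩
    exact ⟨(h a).symm, by rw [← map_star]; exact (h _).symm⟩

/-- Positivity of an element of the commutant may be tested on vectors. -/
lemma isPosElem_commutant {π : A →⋆ₙₐ[ℂ] (H →L[ℂ] H)} (T : commutant π)
    (hs : star T = T) (hT : ∀ v, 0 ≤ (inner ℂ v ((T : H →L[ℂ] H) v)).re) : IsPosElem T := by
  have hT0 : (0 : H →L[ℂ] H) ≤ T := by
    rw [ContinuousLinearMap.nonneg_iff_isPositive, ContinuousLinearMap.isPositive_def']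
    refine ⟨congrArg Subtype.val hs, fun v => ?_⟩
    rw [ContinuousLinearMap.reApplyInnerSelf_apply, inner_re_symm]
    exact hT v
  have hs : CFC.sqrt (T : H →L[ℂ] H) ∈ commutant π := by
    rw [mem_commutant_iff]
    intro a
    exact (mem_commutant_iff.mp T.2 a).cfcₙ_nnreal _
  refine ⟨⟨_, hs⟩, Subtype.ext ?_⟩
  change (T : H →L[ℂ] H) = star (CFC.sqrt (T : H →L[ℂ] H)) * CFC.sqrt (T : H →L[ℂ] H)
  rw [(IsSelfAdjoint.of_nonneg (CFC.sqrt_nonneg _)).star_eq, CFC.sqrt_mul_sqrt_self _ hT0]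

/-- The inclusion of the commutant, as a representation. -/
def commutantInclusion (π : A →⋆ₙₐ[ℂ] (H →L[ℂ] H)) : commutant π →⋆ₙₐ[ℂ] (H →L[ℂ] H) :=
  ((commutant π).subtype : commutant π →⋆ₐ[ℂ] (H →L[ℂ] H))

variable {π : A →⋆ₙₐ[ℂ] (H →L[ℂ] H)} {Λ : A →ₗ[ℂ] H}

lemma norm_sum_commutant_sq_le {n : ℕ} (hd : DenseRange Λ) (hc : Continuous Λ)
    (hΛ : ∀ a b, π a (Λ b) = Λ (a * b))
    (h : ∀ x w : Fin (n + 1) → A,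
      ‖∑ i, π (x i) (Λ (w i))‖ ^ 2 ≤ n * ∑ k, ∑ i, ‖π (x k) (Λ (w i))‖ ^ 2)
    (T : Fin (n + 1) → commutant π) (θ : Fin (n + 1) → H) :
    ‖∑ i, (T i : H →L[ℂ] H) (θ i)‖ ^ 2 ≤ n * ∑ k, ∑ i, ‖(T k : H →L[ℂ] H) (θ i)‖ ^ 2 := by
  have hd' : DenseRange fun w : Fin (n + 1) → A => fun i => Λ (w i) := DenseRange.piMap fun _ => hd
  have h2 : ∀ (x : Fin (n + 1) → A) (ζ : Fin (n + 1) → H),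
      ‖∑ i, π (x i) (ζ i)‖ ^ 2 ≤ n * ∑ k, ∑ i, ‖π (x i) (ζ k)‖ ^ 2 := by
    intro x ζ
    refine hd'.induction_on (p := fun ζ : Fin (n + 1) → H =>
      ‖∑ i, π (x i) (ζ i)‖ ^ 2 ≤ n * ∑ k, ∑ i, ‖π (x i) (ζ k)‖ ^ 2) ζ
      (isClosed_le (by fun_prop) (by fun_prop)) fun w => ?_
    rw [Finset.sum_comm]
    exact h x w
  refine hd'.induction_on (p := fun θ : Fin (n + 1) → H =>
      ‖∑ i, (T i : H →L[ℂ] H) (θ i)‖ ^ 2 ≤ n * ∑ k, ∑ i, ‖(T k : H →L[ℂ] H) (θ i)‖ ^ 2) θ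
      (isClosed_le (by fun_prop) (by fun_prop)) fun b => ?_
  let _ := CStarAlgebra.spectralOrder A
  have _ := CStarAlgebra.spectralOrderedRing A
  have hau := (CStarAlgebra.increasingApproximateUnit A).toIsApproximateUnit
  have hlim : ∀ k i, Tendsto (fun u => π (b i) ((T k : H →L[ℂ] H) (Λ u)))
      (CStarAlgebra.approximateUnit A) (𝓝 ((T k : H →L[ℂ] H) (Λ (b i)))) := by
    intro k i
    have e : ∀ u, π (b i) ((T k : H →L[ℂ] H) (Λ u)) = (T k : H →L[ℂ] H) (Λ (b i * u)) := by
      intro u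
      rw [← hΛ]
      exact (congrArg (fun S : H →L[ℂ] H => S (Λ u)) (mem_commutant_iff.mp (T k).2 (b i))).symm
    simp only [e]
    exact (((T k : H →L[ℂ] H).continuous.comp hc).tendsto _).comp (hau.tendsto_mul_left (b i))
  have hne := hau.neBot
  exact le_of_tendsto_of_tendsto'
    ((tendsto_finsetSum _ fun i _ => hlim i i).norm.pow 2)
    ((tendsto_finsetSum _ fun k _ => tendsto_finsetSum _ fun i _ =>
      (hlim k i).norm.pow 2).const_mul _) (fun u => h2 b fun k => (T k : H →L[ℂ] H) (Λ u))

lemma rowInequality_commutant {n : ℕ} (hd : DenseRange Λ) (hc : Continuous Λ)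
    (hΛ : ∀ a b, π a (Λ b) = Λ (a * b))
    (h : ∀ x w : Fin (n + 1) → A,
      ‖∑ i, π (x i) (Λ (w i))‖ ^ 2 ≤ n * ∑ k, ∑ i, ‖π (x k) (Λ (w i))‖ ^ 2) :
    RowInequality n (commutant π) := by
  intro x w
  refine isPosElem_commutant _ (star_rowElement n x w) fun v => ?_
  have h1 := re_inner_map_rowInequality (commutantInclusion π) x w v
  have h2 := norm_sum_commutant_sq_le hd hc hΛ h x fun i => (w i : H →L[ℂ] H) v
  refine (sub_nonneg.mpr h2).trans_eq h1.symm

end Commutant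

section NPositiveForms

open Filter Topology
open scoped ComplexOrder

/-- The GNS representation of a positive functional. -/
lemma exists_gns {A : Type} [NonUnitalCStarAlgebra A] (τ : A →ₗ[ℂ] ℂ)
    (hτ : ∀ a, 0 ≤ τ (star a * a)) :
    ∃ (H : Type) (_ : NormedAddCommGroup H) (_ : InnerProductSpace ℂ H) (_ : CompleteSpace H)
      (π : A →⋆ₙₐ[ℂ] (H →L[ℂ] H)) (Λ : A →ₗ[ℂ] H), DenseRange Λ ∧ Continuous Λ ∧
      (∀ a b, π a (Λ b) = Λ (a * b)) ∧ ∀ a b, inner ℂ (Λ a) (Λ b) = τ (star a * b) := by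
  let _ := CStarAlgebra.spectralOrder A
  have _ := CStarAlgebra.spectralOrderedRing A
  let g : A →ₚ[ℂ] ℂ := PositiveLinearMap.mk₀ τ fun a ha => by
    obtain ⟨b, rfl⟩ := CStarAlgebra.nonneg_iff_eq_star_mul_self.mp ha
    exact hτ b
  let Λ : A →ₗ[ℂ] g.GNS :=
    UniformSpace.Completion.toComplₗᵢ.toLinearMap ∘ₗ g.toPreGNS.toLinearMap
  have hin : ∀ a b, inner ℂ (Λ a) (Λ b) = τ (star a * b) := fun a b => by
    change inner ℂ ((g.toPreGNS a : g.PreGNS) : g.GNS) ((g.toPreGNS b : g.PreGNS) : g.GNS) = _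
    rw [UniformSpace.Completion.inner_coe, g.preGNS_inner_def]
    rfl
  refine ⟨g.GNS, inferInstance, inferInstance, inferInstance, g.gnsNonUnitalStarAlgHom, Λ,
    ?_, ?_, ?_, hin⟩
  · exact UniformSpace.Completion.denseRange_coe.comp g.toPreGNS.surjective.denseRange
      (UniformSpace.Completion.continuous_coe _)
  · obtain ⟨C, hC⟩ := g.exists_norm_apply_le
    refine AddMonoidHomClass.continuous_of_bound Λ (√C) fun a => ?_
    have h1 : ‖Λ a‖ ^ 2 ≤ C * ‖a‖ ^ 2 := by
      have h2 : (inner ℂ (Λ a) (Λ a)).re = ‖Λ a‖ ^ 2 := inner_self_eq_norm_sq (𝕜 := ℂ) _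
      rw [← h2, hin, sq, ← CStarRing.norm_star_mul_self]
      exact (Complex.re_le_norm _).trans (hC _)
    have hC0 : 0 ≤ (C : ℝ) := by positivity
    refine abs_le_of_sq_le_sq' ?_ (by positivity) |>.2
    rwa [mul_pow, Real.sq_sqrt hC0]
  · intro a b
    exact g.gnsNonUnitalStarAlgHom_apply_coe

lemma norm_apply_le_of_forall_re_nonneg {k : ℕ} {s : Fin k → Fin k → ℂ}
    (hs : ∀ i j, star (s i j) = s j i)
    (h : ∀ d : Fin k → ℂ, 0 ≤ (∑ i, ∑ j, star (d i) * d j * s i j).re) (i j : Fin k) :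
    2 * ‖s i j‖ ≤ (s i i).re + (s j j).re := by
  obtain ⟨μ, hμ, hμs⟩ : ∃ μ : ℂ, ‖μ‖ = 1 ∧ μ * s i j = -(‖s i j‖ : ℂ) := by
    by_cases h0 : s i j = 0
    · exact ⟨1, by simp, by simp [h0]⟩
    · have h1 : (‖s i j‖ : ℂ) ≠ 0 := by exact_mod_cast norm_ne_zero_iff.mpr h0
      refine ⟨-(star (s i j) / ‖s i j‖), ?_, ?_⟩
      · rw [norm_neg, norm_div, norm_star, Complex.norm_real, norm_norm,
          div_self (norm_ne_zero_iff.mpr h0)]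
      · have h2 : star (s i j) * s i j = (‖s i j‖ : ℂ) ^ 2 := by
          rw [← Complex.conj_mul']; rfl
        field_simp
        rw [h2]
  have h1 := h (Pi.single i 1 + μ • Pi.single j 1)
  have h2 : ∑ a, ∑ b, star ((Pi.single i 1 + μ • Pi.single j 1 : Fin k → ℂ) a) *
      (Pi.single i 1 + μ • Pi.single j 1 : Fin k → ℂ) b * s a b =
      s i i + μ * s i j + star μ * s j i + star μ * μ * s j j := by
    have h3 : ∀ x, (starRingEnd ℂ) (if x = j then μ else 0) =
        if x = j then (starRingEnd ℂ) μ else 0 := fun x => by split_ifs <;> simp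
    simp [Pi.single_apply, add_mul, mul_add, Finset.sum_add_distrib, h3]
    ring
  have h3 : star μ * s j i = -(‖s i j‖ : ℂ) := by
    rw [← hs i j, mul_comm, ← star_mul, hμs]
    simp
  have h4 : star μ * μ = 1 := by
    have : star μ * μ = (‖μ‖ : ℂ) ^ 2 := by rw [← Complex.conj_mul']; rfl
    rw [this, hμ]; simp
  rw [h2, h3, h4, hμs] at h1
  simp at h1
  linarith

theorem re_sum_nonneg_of_rowInequality {A : Type} [NonUnitalCStarAlgebra A] {n k : ℕ} (hn : 1 ≤ n)
    (hA : RowInequality n A) (f : Fin k → Fin k → A →ₗ[ℂ] ℂ)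
    (hstar : ∀ i j a, star (f i j a) = f j i (star a))
    (hpos : ∀ (z : Fin n → A) (c : Fin n → Fin k → ℂ),
      0 ≤ (∑ p, ∑ q, ∑ i, ∑ j, star (c p i) * c q j * f i j (star (z p) * z q)).re)
    (x : Fin k → A) : 0 ≤ (∑ i, ∑ j, f i j (star (x i) * x j)).re := by
  have hdiag : ∀ (a : A) (d : Fin k → ℂ),
      0 ≤ (∑ i, ∑ j, star (d i) * d j * f i j (star a * a)).re := fun a d => by
    have := hpos (fun _ => a) (fun p => if p = ⟨0, hn⟩ then d else 0)
    simp only [ite_apply, Pi.zero_apply, apply_ite star, star_zero, ite_mul, zero_mul, mul_ite,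
      mul_zero, Finset.sum_ite_irrel, Finset.sum_const_zero, Finset.sum_ite_eq',
      Finset.mem_univ, if_true] at this
    exact this
  have hoff := fun a => norm_apply_le_of_forall_re_nonneg (s := fun i j => f i j (star a * a))
    (fun i j => by rw [hstar]; simp) (hdiag a)
  have hii : ∀ i a, 0 ≤ f i i (star a * a) := fun i a => by
    have h1 := hoff a i i
    have h2 : star (f i i (star a * a)) = f i i (star a * a) := by rw [hstar]; simp
    refine Complex.nonneg_iff.mpr ⟨?_, (Complex.conj_eq_iff_im.mp h2).symm⟩
    have := norm_nonneg (f i i (star a * a))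
    linarith
  obtain ⟨τ, hτ⟩ : ∃ τ : A →ₗ[ℂ] ℂ, ∀ a, τ a = ∑ i, f i i a :=
    ⟨∑ i, f i i, fun a => by rw [LinearMap.sum_apply]⟩
  have hτ0 : ∀ a, 0 ≤ τ (star a * a) := fun a => by
    rw [hτ]
    exact Finset.sum_nonneg fun i _ => hii i a
  obtain ⟨H, _, _, _, π, Λ, hd, hc, hΛ, hin⟩ := exists_gns τ hτ0
  have hnorm : ∀ a, ‖Λ a‖ ^ 2 = ∑ i, (f i i (star a * a)).re := fun a => by
    rw [← Complex.re_sum, ← hτ, ← hin]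
    exact (inner_self_eq_norm_sq (𝕜 := ℂ) _).symm
  have hbd : ∀ i j a, ‖f i j (star a * a)‖ ≤ ‖Λ a‖ ^ 2 := fun i j a => by
    have h1 : ∀ l, (f l l (star a * a)).re ≤ ‖Λ a‖ ^ 2 := fun l => by
      rw [hnorm]
      exact Finset.single_le_sum (f := fun l => (f l l (star a * a)).re)
        (fun l _ => (Complex.nonneg_iff.mp (hii l a)).1) (Finset.mem_univ l)
    linarith [hoff a i j, h1 i, h1 j]
  let B : Fin k → Fin k → A →ₗ⋆[ℂ] A →ₗ[ℂ] ℂ := fun i j =>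
    LinearMap.mk₂'ₛₗ (starRingEnd ℂ) (RingHom.id ℂ) (fun a b => f i j (star a * b))
      (fun a b c => by simp [add_mul]) (fun r a b => by simp [smul_mul_assoc])
      (fun a b c => by simp [mul_add]) (fun r a b => by simp [mul_smul_comm])
  choose T hT using fun i j => exists_operator_of_sesq hd (B i j)
    (norm_sesq_le Λ (B i j) (hbd i j))
  have hTB : ∀ i j a b, inner ℂ (Λ a) (T i j (Λ b)) = f i j (star a * b) := hT
  have hext : ∀ S S' : H →L[ℂ] H,
      (∀ a b, inner ℂ (Λ a) (S (Λ b)) = inner ℂ (Λ a) (S' (Λ b))) → S = S' := by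
    intro S S' h
    refine ContinuousLinearMap.ext fun v => congrFun (hd.equalizer S.continuous S'.continuous
      (funext fun b => ?_)) v
    rw [← sub_eq_zero]
    refine hd.eq_zero_of_inner_right (𝕜 := ℂ) fun a => ?_
    rw [inner_sub_right, sub_eq_zero]
    exact h a b
  have hTmem : ∀ i j, T i j ∈ commutant π := fun i j => by
    rw [mem_commutant_iff]
    intro c
    refine hext _ _ fun a b => ?_
    rw [mul_apply_eq_comp, mul_apply_eq_comp, hΛ, hTB, ← ContinuousLinearMap.adjoint_inner_left,
      ← ContinuousLinearMap.star_eq_adjoint, ← map_star, hΛ, hTB, star_mul, star_star, mul_assoc]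
  have hTstar : ∀ i j, star (T i j) = T j i := fun i j => by
    refine hext _ _ fun a b => ?_
    rw [ContinuousLinearMap.star_eq_adjoint, ContinuousLinearMap.adjoint_inner_right,
      ← inner_conj_symm, hTB, hTB]
    change star _ = _
    rw [hstar, star_mul, star_star]
  have hN : RowInequality n (commutant π) := by
    refine rowInequality_commutant hd hc hΛ fun x w => ?_
    obtain ⟨b, hb⟩ := hA x w
    have h1 := (Complex.nonneg_iff.mp (hτ0 b)).1
    rw [← hb] at h1
    simp only [map_sub, map_smul, map_sum, ← hin, smul_eq_mul, inner_self_eq_norm_sq_to_K] at h1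
    have h2 : 0 ≤ n * ∑ k, ∑ i, ‖Λ (x k * w i)‖ ^ 2 - ‖∑ i, Λ (x i * w i)‖ ^ 2 := by
      rw [← Complex.ofReal_re (_ - _)]
      push_cast
      exact h1
    simp only [hΛ]
    linarith
  have hform : ∀ (c : Fin n → Fin k → ℂ) (θ : Fin n → H),
      0 ≤ (∑ p, ∑ q, ∑ i, ∑ j, star (c p i) * c q j * inner ℂ (θ p) (T i j (θ q))).re := by
    intro c θ
    refine (DenseRange.piMap fun _ => hd).induction_on (p := fun θ : Fin n → H =>
      0 ≤ (∑ p, ∑ q, ∑ i, ∑ j, star (c p i) * c q j * inner ℂ (θ p) (T i j (θ q))).re) θ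
      (isClosed_le (by fun_prop) (by fun_prop)) fun z => ?_
    simp only [Pi.map_apply, hTB]
    exact hpos z c
  let M : Matrix (Fin k) (Fin k) (commutant π) := fun i j => ⟨T i j, hTmem i j⟩
  have hMs : ∀ i j, star (M i j) = M j i := fun i j => Subtype.ext (hTstar i j)
  have hM : IsPosElem M := by
    refine isPosElem_of_forall_span hN ?_ fun R c => isPosElem_commutant _ ?_ fun v => ?_
    · refine Matrix.ext fun i j => hMs j i
    · simp only [star_sum, star_mul, star_star, star_smul, hMs]
      rw [Finset.sum_comm]
      refine Finset.sum_congr rfl fun p _ => Finset.sum_congr rfl fun q _ => ?_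
      rw [Finset.sum_comm, mul_assoc]
    · refine (hform c fun p => (R p : H →L[ℂ] H) v).trans_eq ?_
      have e1 : ∀ (S S' : commutant π) (S₀ : H →L[ℂ] H), inner ℂ v
          ((star (S : H →L[ℂ] H) * S₀ * (S' : H →L[ℂ] H)) v) =
          inner ℂ ((S : H →L[ℂ] H) v) (S₀ ((S' : H →L[ℂ] H) v)) := fun S S' S₀ => by
        rw [ContinuousLinearMap.star_eq_adjoint, mul_apply_eq_comp, mul_apply_eq_comp,
          ContinuousLinearMap.adjoint_inner_right]
      simp only [AddSubmonoidClass.coe_finsetSum, MulMemClass.coe_mul, StarMemClass.coe_star,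
        SetLike.val_smul, sum_apply, inner_sum, e1, smul_apply, inner_smul_right, M]
  obtain ⟨b, hb⟩ := hM.exists_gram
  have hfinal : ∑ i, ∑ j, f i j (star (x i) * x j) =
      ∑ r, inner ℂ (∑ i, (b r i : H →L[ℂ] H) (Λ (x i))) (∑ i, (b r i : H →L[ℂ] H) (Λ (x i))) := by
    have e1 : ∀ i j, f i j (star (x i) * x j) = ∑ r, inner ℂ
        ((b r i : H →L[ℂ] H) (Λ (x i))) ((b r j : H →L[ℂ] H) (Λ (x j))) := by
      intro i j
      have h1 : T i j = ∑ r, star (b r i : H →L[ℂ] H) * (b r j : H →L[ℂ] H) := by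
        have := congrArg Subtype.val (hb i j)
        simpa only [AddSubmonoidClass.coe_finsetSum, MulMemClass.coe_mul,
          StarMemClass.coe_star] using this
      rw [← hTB, h1, sum_apply, inner_sum]
      refine Finset.sum_congr rfl fun r _ => ?_
      rw [ContinuousLinearMap.star_eq_adjoint, mul_apply_eq_comp,
        ContinuousLinearMap.adjoint_inner_right]
    simp only [e1, sum_inner, inner_sum]
    rw [Finset.sum_comm, Finset.sum_congr rfl fun j _ => Finset.sum_comm, Finset.sum_comm]
  rw [hfinal, Complex.re_sum]
  exact Finset.sum_nonneg fun r _ => inner_self_nonneg (𝕜 := ℂ)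

end NPositiveForms

section CompletePositivity

open scoped ComplexOrder

lemma star_map_of_positive {A B : Type*} [NonUnitalCStarAlgebra A] [NonUnitalCStarAlgebra B]
    {φ : A →ₗ[ℂ] B} (hφ : ∀ a, IsPosElem (φ (star a * a))) (a : A) : star (φ a) = φ (star a) := by
  let _ := CStarAlgebra.spectralOrder A
  have _ := CStarAlgebra.spectralOrderedRing A
  let _ := CStarAlgebra.spectralOrder B
  have _ := CStarAlgebra.spectralOrderedRing B
  let g : A →ₚ[ℂ] B := PositiveLinearMap.mk₀ φ fun a ha => by
    obtain ⟨b, rfl⟩ := CStarAlgebra.nonneg_iff_eq_star_mul_self.mp ha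
    exact isPosElem_iff_nonneg.mp (hφ b)
  exact (map_star g a).symm

/-- A matrix which is not positive is separated from the positive ones by a matrix of
functionals. -/
lemma exists_entry_functionals {B : Type*} [NonUnitalCStarAlgebra B] {k : ℕ}
    {Y : Matrix (Fin k) (Fin k) B} (hY : star Y = Y) (hn : ¬ IsPosElem Y) :
    ∃ g : Fin k → Fin k → B →ₗ[ℂ] ℂ,
      (∀ V : Matrix (Fin k) (Fin k) B, IsPosElem V → 0 ≤ ∑ i, ∑ j, g i j (V i j)) ∧
      (∀ i j b, star (g i j b) = g j i (star b)) ∧ (∑ i, ∑ j, g i j (Y i j)).re < 0 := by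
  let _ := CStarAlgebra.spectralOrder B
  have _ := CStarAlgebra.spectralOrderedRing B
  obtain ⟨ω, hω, hωY⟩ := exists_positive_functional_neg (A := CStarMatrix (Fin k) (Fin k) B)
    (h := Y) hY hn
  have hs := star_map_of_positive (A := CStarMatrix (Fin k) (Fin k) B) (φ := ω) fun a => by
    obtain ⟨b, hb⟩ := isPosElem_iff_nonneg.mpr (hω a)
    exact ⟨b, hb⟩
  let g : Fin k → Fin k → B →ₗ[ℂ] ℂ := fun i j =>
    { toFun := fun b => ω (CStarMatrix.ofMatrix (Matrix.single i j b))
      map_add' := fun a b => by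
        rw [Matrix.single_add]
        exact ω.map_add _ _
      map_smul' := fun r b => by
        rw [← Matrix.smul_single]
        exact ω.map_smul _ _ }
  have hg : ∀ V : Matrix (Fin k) (Fin k) B,
      ω (CStarMatrix.ofMatrix V) = ∑ i, ∑ j, g i j (V i j) := fun V => by
    conv_lhs => rw [Matrix.matrix_eq_sum_single V]
    let ω' : Matrix (Fin k) (Fin k) B →ₗ[ℂ] ℂ := ω
    change ω' (∑ i, ∑ j, Matrix.single i j (V i j)) = _
    simp only [map_sum]
    rfl
  refine ⟨g, fun V hV => ?_, fun i j b => ?_, ?_⟩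
  · obtain ⟨b, rfl⟩ := hV
    rw [← hg]
    exact hω b
  · change star (ω (CStarMatrix.ofMatrix (Matrix.single i j b))) = _
    rw [hs]
    refine congrArg ω ?_
    exact Matrix.conjTranspose_single i j b
  · rw [← hg]
    exact hωY

lemma KPositive.isPosElem_map_star_mul_self {A B : Type*} [NonUnitalCStarAlgebra A]
    [NonUnitalCStarAlgebra B] {n : ℕ} (hn : 1 ≤ n) {φ : A →ₗ[ℂ] B} (hφ : KPositive n φ) (a : A) :
    IsPosElem (φ (star a * a)) := by
  obtain ⟨d, hd⟩ := (hφ _ (isPosElem_gram fun (_ : Unit) (_ : Fin n) => a)).exists_gram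
  have h1 := hd ⟨0, hn⟩ ⟨0, hn⟩
  simp only [Matrix.map_apply, Matrix.of_apply, Finset.univ_unique, Finset.sum_singleton] at h1
  rw [h1]
  exact isPosElem_sum _ _ fun r _ => ⟨_, rfl⟩

lemma RowInequality.completelyPositive {A : Type} [NonUnitalCStarAlgebra A] {n : ℕ} (hn : 1 ≤ n)
    (hA : RowInequality n A) {B : Type*} [NonUnitalCStarAlgebra B] {φ : A →ₗ[ℂ] B}
    (hφ : KPositive n φ) : CompletelyPositive φ := by
  intro k X hX
  have hφs := star_map_of_positive (hφ.isPosElem_map_star_mul_self hn)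
  have hXs : star X = X := by
    obtain ⟨b, rfl⟩ := hX
    simp
  by_contra hneg
  obtain ⟨g, hg, hgs, hgY⟩ := exists_entry_functionals (Y := X.map φ) (by
    refine Matrix.ext fun i j => ?_
    rw [Matrix.star_apply, Matrix.map_apply, Matrix.map_apply, hφs]
    exact congrArg φ (congrFun (congrFun hXs i) j)) hneg
  obtain ⟨b, hb⟩ := hX.exists_gram
  have hpos : ∀ (z : Fin n → A) (c : Fin n → Fin k → ℂ), 0 ≤ (∑ p, ∑ q, ∑ i, ∑ j,
      star (c p i) * c q j * (g i j ∘ₗ φ) (star (z p) * z q)).re := by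
    intro z c
    obtain ⟨d, hd⟩ := (hφ _ (isPosElem_gram fun (_ : Unit) (p : Fin n) => z p)).exists_gram
    simp only [Matrix.map_apply, Matrix.of_apply, Finset.univ_unique, Finset.sum_singleton] at hd
    refine (Complex.nonneg_iff.mp (hg _ (isPosElem_gram fun (r : Fin n) (i : Fin k) =>
      ∑ p, c p i • d r p))).1.trans_eq (congrArg Complex.re ?_)
    have e1 : ∀ i j, g i j (∑ r, star (∑ p, c p i • d r p) * ∑ q, c q j • d r q) =
        ∑ p, ∑ q, star (c p i) * c q j * g i j (φ (star (z p) * z q)) := by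
      intro i j
      simp only [hd, star_sum, star_smul, Finset.sum_mul_sum, smul_mul_smul_comm, map_sum,
        map_smul, smul_eq_mul]
      simp only [Finset.mul_sum]
      rw [Finset.sum_comm]
      exact Finset.sum_congr rfl fun p _ => Finset.sum_comm
    simp only [Matrix.of_apply, e1,
      LinearMap.comp_apply]
    symm
    rw [Finset.sum_congr rfl fun p _ => Finset.sum_comm, Finset.sum_comm]
    refine Finset.sum_congr rfl fun i _ => ?_
    rw [Finset.sum_congr rfl fun p _ => Finset.sum_comm, Finset.sum_comm]
  have h1 : ∀ r, 0 ≤ (∑ i, ∑ j, (g i j ∘ₗ φ) (star (b r i) * b r j)).re := fun r =>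
    re_sum_nonneg_of_rowInequality hn hA (fun i j => g i j ∘ₗ φ)
      (fun i j a => by rw [LinearMap.comp_apply, hgs, hφs]; rfl) hpos (b r)
  have h2 : ∑ i, ∑ j, g i j (X.map φ i j) =
      ∑ r, ∑ i, ∑ j, (g i j ∘ₗ φ) (star (b r i) * b r j) := by
    simp only [Matrix.map_apply, hb, map_sum, LinearMap.comp_apply]
    rw [Finset.sum_congr rfl fun i _ => Finset.sum_comm, Finset.sum_comm]
  rw [h2, Complex.re_sum] at hgY
  exact absurd hgY (not_lt.mpr (Finset.sum_nonneg fun r _ => h1 r))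

end CompletePositivity

/-- **Choi–Tomiyama–Smith.** If every `n`-positive linear map `A → A` is
`(n+1)`-positive, then `A` is `n`-subhomogeneous; conversely, if `A` is
`n`-subhomogeneous then every `n`-positive map from `A` into any C*-algebra `B` is
completely positive. -/
theorem stmt15 (n : ℕ) (hn : 1 ≤ n) (A : Type) [NonUnitalCStarAlgebra A] :
    ((∀ φ : A →ₗ[ℂ] A, KPositive n φ → KPositive (n + 1) φ) → IsSubhomogeneous n A) ∧
      (IsSubhomogeneous n A →
        ∀ (B : Type) (_ : NonUnitalCStarAlgebra B) (φ : A →ₗ[ℂ] B),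
          KPositive n φ → CompletelyPositive φ) := by
  exact ⟨fun h _ _ _ _ _ hπ => rank_le_of_kPositive_imp h hπ,
    fun hA _ _ _ hφ => hA.rowInequality.completelyPositive hn hφ⟩

end
end

section
/- Let A and B be C*-algebras each admitting an irreducible representation of dimension ≥ n+1. Then there exists a linear map A → B that is n-contractive but not (n+1)-contractive. -/
noncomputable section

/-- `A` admits an irreducible representation of dimension at least `d`. -/
structure HasIrrepOfDimGe (A : Type) [NonUnitalCStarAlgebra A] (d : ℕ) where
  H : Type
  [i1 : NormedAddCommGroup H]
  [i2 : InnerProductSpace ℂ H]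
  [i3 : CompleteSpace H]
  π : A →⋆ₙₐ[ℂ] (H →L[ℂ] H)
  irr : IsIrreducibleRep π
  dim : (d : Cardinal) ≤ Module.rank ℂ H

/-- `N` is a C*-norm on the `*`-algebra `E`. -/
structure IsCStarNormOn (E : Type*) [NonUnitalRing E] [StarRing E] [Module ℂ E]
    (N : E → ℝ) : Prop where
  eq_zero : ∀ x, N x = 0 ↔ x = 0
  add_le : ∀ x y, N (x + y) ≤ N x + N y
  smul : ∀ (c : ℂ) (x), N (c • x) = ‖c‖ * N x
  mul_le : ∀ x y, N (x * y) ≤ N x * N y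
  star_mul_self : ∀ x, N (star x * x) = N x * N x

/-- `φ : A → B` is `k`-contractive: `φ ⊗ id_{M_k} : M_k(A) → M_k(B)` (given by entrywise
application) is contractive with respect to the (unique) C*-norms on `M_k(A)`, `M_k(B)`. -/
def KContractive {A B : Type} [NonUnitalCStarAlgebra A] [NonUnitalCStarAlgebra B]
    (k : ℕ) (φ : A →ₗ[ℂ] B) : Prop :=
  ∀ (NA : Matrix (Fin k) (Fin k) A → ℝ) (NB : Matrix (Fin k) (Fin k) B → ℝ),
    IsCStarNormOn _ NA → IsCStarNormOn _ NB →
      ∀ x : Matrix (Fin k) (Fin k) A, NB (x.map φ) ≤ NA x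

/-- `φ : A → B` is not `k`-contractive: `φ ⊗ id_{M_k}` increases the C*-norm somewhere. -/
def NotKContractive {A B : Type} [NonUnitalCStarAlgebra A] [NonUnitalCStarAlgebra B]
    (k : ℕ) (φ : A →ₗ[ℂ] B) : Prop :=
  ∀ (NA : Matrix (Fin k) (Fin k) A → ℝ) (NB : Matrix (Fin k) (Fin k) B → ℝ),
    IsCStarNormOn _ NA → IsCStarNormOn _ NB →
      ∃ x : Matrix (Fin k) (Fin k) A, NA x < NB (x.map φ)

namespace IsCStarNormOn

variable {E : Type*}

section Basic

variable [NonUnitalRing E] [StarRing E] [Module ℂ E] {N : E → ℝ}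

lemma map_zero (hN : IsCStarNormOn E N) : N 0 = 0 := (hN.eq_zero 0).2 rfl

lemma nonneg (hN : IsCStarNormOn E N) (x : E) : 0 ≤ N x := by
  have h1 : N (-x) = N x := by simpa using hN.smul (-1) x
  have h2 := hN.add_le x (-x)
  rw [add_neg_cancel, hN.map_zero, h1] at h2
  linarith

lemma sum_le (hN : IsCStarNormOn E N) {ι : Type*} (s : Finset ι) (f : ι → E) :
    N (∑ i ∈ s, f i) ≤ ∑ i ∈ s, N (f i) :=
  Finset.le_sum_of_subadditive N hN.map_zero.le hN.add_le s f

end Basic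

variable [NonUnitalCStarAlgebra E] {N : E → ℝ}

/-- Left multiplication by a self-adjoint contraction does not increase a C⋆-norm. -/
lemma mul_le_of_isSelfAdjoint (hN : IsCStarNormOn E N) {h : E} (hh : IsSelfAdjoint h)
    (h1 : ‖h‖ ≤ 1) (x : E) : N (h * x) ≤ N x := by
  set f : ℝ → ℝ := fun t => 1 - √(1 - t ^ 2)
  set s : E := cfcₙ f h
  have hf : ContinuousOn f (quasispectrum ℝ h) := by fun_prop
  have hf0 : f 0 = 0 := by simp [f]
  have hss : IsSelfAdjoint s := cfcₙ_predicate f h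
  have hcomm : s * h = h * s := by
    have : h = cfcₙ (id : ℝ → ℝ) h := (cfcₙ_id ℝ h).symm
    conv_lhs => rw [this]
    conv_rhs => rw [this]
    exact cfcₙ_commute_cfcₙ _ _ _
  have hrel : h * h + s * s = s + s := by
    have e1 : h * h = cfcₙ (fun t : ℝ => t * t) h := by
      rw [cfcₙ_mul (fun t => t) (fun t => t) h (by fun_prop) rfl (by fun_prop) rfl, cfcₙ_id' ℝ h]
    rw [e1, ← cfcₙ_mul f f h hf hf0 hf hf0, ← cfcₙ_add f f h hf hf0 hf hf0,
      ← cfcₙ_add (fun t : ℝ => t * t) (fun t => f t * f t) h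
        (by fun_prop) (by simp) (hf.mul hf) (by simp [hf0])]
    refine cfcₙ_congr fun t ht => ?_
    have ht1 : |t| ≤ 1 :=
      (NonUnitalIsometricContinuousFunctionalCalculus.norm_quasispectrum_le h ht hh).trans h1
    have : 0 ≤ 1 - t ^ 2 := by
      have := (sq_le_one_iff_abs_le_one t).2 ht1
      linarith
    have := Real.sq_sqrt this
    simp only [f]
    nlinarith
  have hunit : ∀ c : ℂ, star c = -c → c * c = -1 → N (h * x + c • (x - s * x)) = N x := by
    intro c hc hc2
    have : star (h * x + c • (x - s * x)) * (h * x + c • (x - s * x)) = star x * x := by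
      have h3 : star x * (h * (h * x)) = star x * (s * x) + star x * (s * x)
          - star x * (s * (s * x)) := by
        rw [← mul_assoc h, eq_sub_of_add_eq hrel]
        simp only [sub_mul, add_mul, mul_sub, mul_add, mul_assoc]
      have h4 : star x * (s * (h * x)) = star x * (h * (s * x)) := by
        rw [← mul_assoc s, hcomm, mul_assoc]
      simp only [star_add, star_smul, star_sub, star_mul, hh.star_eq, hss.star_eq, hc, add_mul,
        mul_add, mul_sub, sub_mul, smul_mul_assoc, mul_smul_comm, neg_smul, smul_sub, mul_assoc,
        smul_smul, smul_add, smul_neg, hc2, h3, h4, neg_neg, neg_mul, one_smul]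
      abel
    have h5 := hN.star_mul_self (h * x + c • (x - s * x))
    rw [this, hN.star_mul_self] at h5
    exact ((mul_self_inj (hN.nonneg _) (hN.nonneg _)).1 h5).symm
  have h2 := hN.add_le (h * x + Complex.I • (x - s * x)) (h * x + (-Complex.I) • (x - s * x))
  rw [hunit _ (by simp) (by simp), hunit _ (by simp) (by simp)] at h2
  have h3 : h * x + Complex.I • (x - s * x) + (h * x + (-Complex.I) • (x - s * x))
      = (2 : ℂ) • (h * x) := by
    rw [two_smul, neg_smul]; abel
  rw [h3, hN.smul] at h2
  norm_num at h2
  linarith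

lemma le_norm_of_isSelfAdjoint (hN : IsCStarNormOn E N) {h : E} (hh : IsSelfAdjoint h) :
    N h ≤ ‖h‖ := by
  rcases eq_or_ne h 0 with rfl | h0
  · simp [hN.map_zero]
  have hpos : 0 < ‖h‖ := norm_pos_iff.2 h0
  have hh' : IsSelfAdjoint ((‖h‖⁻¹ : ℝ) • h) := by
    rw [isSelfAdjoint_iff, star_smul, hh.star_eq]; simp
  have h1 := hN.mul_le_of_isSelfAdjoint hh' (by simp [norm_smul, hpos.ne']) h
  have h2 : (‖h‖⁻¹ : ℝ) • h * h = ((‖h‖⁻¹ : ℝ) : ℂ) • (star h * h) := by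
    rw [hh.star_eq, smul_mul_assoc]; rfl
  rw [h2, hN.smul, hN.star_mul_self] at h1
  have hN0 : 0 < N h := (hN.nonneg h).lt_of_ne fun e => h0 ((hN.eq_zero h).1 e.symm)
  simp only [Complex.norm_real, norm_inv, norm_norm] at h1
  rw [inv_mul_le_iff₀ hpos] at h1
  exact le_of_mul_le_mul_right h1 hN0

lemma norm_le_of_isSelfAdjoint (hN : IsCStarNormOn E N) {h : E} (hh : IsSelfAdjoint h) :
    ‖h‖ ≤ N h := by
  refine le_of_forall_lt_imp_le_of_dense fun r hrM => ?_
  rcases le_or_gt r 0 with hr | hr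
  · exact hr.trans (hN.nonneg h)
  obtain ⟨t₀, ht₀, ht₀M⟩ := (IsGreatest.norm_cfcₙ (fun t : ℝ => t) h (by fun_prop) rfl hh).1
  rw [cfcₙ_id' ℝ h] at ht₀M
  set g : ℝ → ℝ := fun t => max (|t| - r) 0
  set k : ℝ → ℝ := fun t => t / max (t ^ 2) (r ^ 2)
  have hden : ∀ t : ℝ, 0 < max (t ^ 2) (r ^ 2) := fun t => lt_max_of_lt_right (by positivity)
  have hk : Continuous k := by
    refine continuous_id.div (by fun_prop) fun t => (hden t).ne'
  have hg : Continuous g := by fun_prop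
  have hg0 : g 0 = 0 := by simp [g, hr.le]
  have hk0 : k 0 = 0 := by simp [k]
  have hG : cfcₙ g h ≠ 0 := by
    intro h0
    have := norm_apply_le_norm_cfcₙ g h ht₀ hg.continuousOn hg0 hh
    rw [h0, norm_zero] at this
    have h1 : g t₀ = 0 := norm_le_zero_iff.1 this
    have h2 : |t₀| - r ≤ g t₀ := le_max_left _ _
    simp only [Real.norm_eq_abs] at ht₀M
    linarith
  have hprod : cfcₙ g h = cfcₙ k h * (h * cfcₙ g h) := by
    have e : h * cfcₙ g h = cfcₙ (fun t => t * g t) h := by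
      rw [cfcₙ_mul (fun t => t) g h (by fun_prop) rfl hg.continuousOn hg0, cfcₙ_id' ℝ h]
    rw [e, ← cfcₙ_mul k (fun t => t * g t) h hk.continuousOn hk0 (by fun_prop) (by simp)]
    refine cfcₙ_congr fun t _ => ?_
    rcases le_total |t| r with h' | h'
    · simp [g, h']
    · have h3 : r ^ 2 ≤ t ^ 2 := sq_le_sq.2 (by rwa [abs_of_pos hr])
      have h4 : t ≠ 0 := by rintro rfl; simp at h'; linarith
      simp only [k, max_eq_left h3]
      field_simp
  have hK : N (cfcₙ k h) ≤ r⁻¹ := by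
    refine (hN.le_norm_of_isSelfAdjoint (cfcₙ_predicate k h)).trans (norm_cfcₙ_le fun t _ => ?_)
    rw [Real.norm_eq_abs, abs_div, abs_of_pos (hden t), div_le_iff₀ (hden t), inv_mul_eq_div,
      le_div_iff₀ hr]
    rcases le_total |t| r with h' | h'
    · refine le_trans ?_ (le_max_right _ _)
      nlinarith [abs_nonneg t]
    · refine le_trans ?_ (le_max_left _ _)
      nlinarith [abs_nonneg t, sq_abs t]
  have hNG : 0 < N (cfcₙ g h) :=
    (hN.nonneg _).lt_of_ne fun e => hG ((hN.eq_zero _).1 e.symm)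
  have h1 : N (cfcₙ g h) ≤ r⁻¹ * (N h * N (cfcₙ g h)) := by
    conv_lhs => rw [hprod]
    refine (hN.mul_le _ _).trans (mul_le_mul hK (hN.mul_le _ _) (hN.nonneg _) (by positivity))
  rw [← mul_assoc] at h1
  have h2 := le_of_mul_le_mul_right ((one_mul _).le.trans h1) hNG
  rwa [inv_mul_eq_div, one_le_div hr] at h2

/-- A C⋆-algebra carries exactly one C⋆-norm. -/
lemma eq_norm (hN : IsCStarNormOn E N) (x : E) : N x = ‖x‖ := by
  have h := le_antisymm (hN.le_norm_of_isSelfAdjoint (.star_mul_self x))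
    (hN.norm_le_of_isSelfAdjoint (.star_mul_self x))
  rw [hN.star_mul_self, CStarRing.norm_star_mul_self] at h
  exact (mul_self_inj (hN.nonneg _) (norm_nonneg _)).1 h

end IsCStarNormOn

section MatrixCLM

variable {ι H : Type*} [Fintype ι] [NormedAddCommGroup H] [InnerProductSpace ℂ H]

/-- The operator on the Hilbert sum of copies of `H` with the given matrix of operators. -/
def matrixCLM (T : ι → ι → H →L[ℂ] H) :
    PiLp 2 (fun _ : ι => H) →L[ℂ] PiLp 2 (fun _ : ι => H) :=
  (PiLp.continuousLinearEquiv 2 ℂ (fun _ : ι => H)).symm ∘L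
    ContinuousLinearMap.pi fun i => ∑ j, T i j ∘L PiLp.proj 2 (fun _ : ι => H) j

@[simp]
lemma matrixCLM_apply (T : ι → ι → H →L[ℂ] H) (x : PiLp 2 (fun _ : ι => H)) (i : ι) :
    matrixCLM T x i = ∑ j, T i j (x j) := by
  simp [matrixCLM]

lemma matrixCLM_mul (S T : ι → ι → H →L[ℂ] H) :
    matrixCLM S * matrixCLM T = matrixCLM fun i k => ∑ j, S i j * T j k := by
  ext x i
  simp only [mul_apply_eq_comp, matrixCLM_apply, map_sum,
    sum_apply]
  exact Finset.sum_comm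

lemma star_matrixCLM [CompleteSpace H] (T : ι → ι → H →L[ℂ] H) :
    star (matrixCLM T) = matrixCLM fun i j => star (T j i) := by
  rw [ContinuousLinearMap.star_eq_adjoint, eq_comm, ContinuousLinearMap.eq_adjoint_iff]
  intro x y
  simp only [PiLp.inner_apply, matrixCLM_apply, sum_inner, inner_sum,
    ContinuousLinearMap.star_eq_adjoint, ContinuousLinearMap.adjoint_inner_left]
  exact Finset.sum_comm

/-- The diagonal operator on the Hilbert sum of copies of `H`. -/
def diagCLM (ι : Type*) [Fintype ι] (T : H →L[ℂ] H) :
    PiLp 2 (fun _ : ι => H) →L[ℂ] PiLp 2 (fun _ : ι => H) :=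
  (PiLp.continuousLinearEquiv 2 ℂ (fun _ : ι => H)).symm ∘L
    ContinuousLinearMap.pi fun i => T ∘L PiLp.proj 2 (fun _ : ι => H) i

@[simp]
lemma diagCLM_apply (T : H →L[ℂ] H) (x : PiLp 2 (fun _ : ι => H)) (i : ι) :
    diagCLM ι T x i = T (x i) := rfl

lemma star_diagCLM [CompleteSpace H] (T : H →L[ℂ] H) : star (diagCLM ι T) = diagCLM ι (star T) := by
  rw [ContinuousLinearMap.star_eq_adjoint, eq_comm, ContinuousLinearMap.eq_adjoint_iff]
  intro x y
  simp [PiLp.inner_apply, ContinuousLinearMap.star_eq_adjoint,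
    ContinuousLinearMap.adjoint_inner_left]

end MatrixCLM

section Irreducible

variable {E : Type*} [NonUnitalCStarAlgebra E] {K : Type*} [NormedAddCommGroup K]
  [InnerProductSpace ℂ K] [CompleteSpace K] {ρ : E →⋆ₙₐ[ℂ] (K →L[ℂ] K)}

namespace IsIrreducibleRep

lemma eq_zero_of_forall_apply_eq_zero (hρ : IsIrreducibleRep ρ) {z : K} (hz : ∀ a, ρ a z = 0) :
    z = 0 := by
  let S : Submodule ℂ K := ⨅ a, (ρ a).ker
  have hS : ∀ x, x ∈ S ↔ ∀ a, ρ a x = 0 := fun x => by simp [S]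
  have hcl : IsClosed (S : Set K) := by
    have : (S : Set K) = ⋂ a, {x | ρ a x = 0} := by ext x; simp [hS]
    rw [this]
    exact isClosed_iInter fun a => isClosed_eq (ρ a).continuous continuous_const
  rcases hρ.2 S hcl fun a v hv => by rw [(hS v).1 hv a]; exact S.zero_mem with h | h
  · have : z ∈ S := (hS z).2 hz
    rwa [h, Submodule.mem_bot] at this
  · obtain ⟨a, ha⟩ := hρ.1
    exact absurd (ContinuousLinearMap.ext fun x => (hS x).1 (h ▸ Submodule.mem_top) a) ha

/-- In an irreducible representation, the vectors `ρ a z` are dense for each nonzero `z`. -/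
lemma eq_top_of_forall_apply_mem (hρ : IsIrreducibleRep ρ) {z : K} (hz : z ≠ 0)
    {S : Submodule ℂ K} (hS : IsClosed (S : Set K)) (h : ∀ a, ρ a z ∈ S) : S = ⊤ := by
  let f : E →ₗ[ℂ] K :=
    { toFun := fun a => ρ a z
      map_add' := fun a b => by simp
      map_smul' := fun c a => by simp }
  let R : Submodule ℂ K := (LinearMap.range f).topologicalClosure
  have hfR : ∀ a, ρ a z ∈ R := fun a => Submodule.le_topologicalClosure _ ⟨a, rfl⟩
  have hRS : R ≤ S := Submodule.topologicalClosure_minimal _ (by rintro _ ⟨a, rfl⟩; exact h a) hS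
  have hinv : ∀ a, ∀ v ∈ R, ρ a v ∈ R := fun a =>
    Submodule.topologicalClosure_minimal (t := R.comap (ρ a).toLinearMap) _
      (by rintro _ ⟨b, rfl⟩; simpa [f] using hfR (a * b))
      ((Submodule.isClosed_topologicalClosure _).preimage (ρ a).continuous)
  rcases hρ.2 R (Submodule.isClosed_topologicalClosure _) hinv with h' | h'
  · refine absurd (hρ.eq_zero_of_forall_apply_eq_zero fun a => ?_) hz
    simpa [h'] using hfR a
  · exact top_le_iff.1 (h' ▸ hRS)

/-- If `S * T = 0` with `T ≠ 0`, and `S` lies in the commutant, then `S = 0`. -/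
lemma eq_zero_of_mul_eq_zero (hρ : IsIrreducibleRep ρ) {S T : K →L[ℂ] K}
    (hS : ∀ a, Commute S (ρ a)) (hT : T ≠ 0) (hST : S * T = 0) : S = 0 := by
  rcases hρ.2 S.ker S.isClosed_ker fun a v hv => by
    have := congr($(hS a) v)
    simp only [mul_apply_eq_comp] at this
    rw [LinearMap.mem_ker] at hv ⊢
    simp_all with h | h
  · refine absurd (ContinuousLinearMap.ext fun x => ?_) hT
    have : T x ∈ S.ker := congr($hST x)
    rw [h] at this
    exact this
  · ext x
    have : x ∈ S.ker := h ▸ Submodule.mem_top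
    exact this

lemma exists_eq_smul_of_isSelfAdjoint_s16 (hρ : IsIrreducibleRep ρ) {T : K →L[ℂ] K}
    (hT : ∀ a, Commute T (ρ a)) (hsa : IsSelfAdjoint T) : ∃ c : ℂ, T = c • 1 := by
  have hspec : (spectrum ℝ T).Subsingleton := by
    have key : ∀ s ∈ spectrum ℝ T, ∀ t ∈ spectrum ℝ T, ¬ s < t := by
      intro s hs t ht hst
      set r := (s + t) / 2
      have hf : ContinuousOn (fun x : ℝ => max (x - r) 0) (spectrum ℝ T) := by fun_prop
      have hg : ContinuousOn (fun x : ℝ => max (r - x) 0) (spectrum ℝ T) := by fun_prop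
      have h1 : cfc (fun x : ℝ => max (x - r) 0) T * cfc (fun x : ℝ => max (r - x) 0) T = 0 := by
        rw [← cfc_mul _ _ T hf hg]
        have : ∀ x : ℝ, max (x - r) 0 * max (r - x) 0 = 0 := fun x => by
          rcases le_total x r with h | h
          · rw [max_eq_right (sub_nonpos.2 h), zero_mul]
          · rw [max_eq_right (sub_nonpos.2 h), mul_zero]
        simp [this]
      have hne : ∀ f : ℝ → ℝ, ContinuousOn f (spectrum ℝ T) → ∀ x ∈ spectrum ℝ T, f x ≠ 0 →
          cfc f T ≠ 0 := by
        intro f hf x hx hfx h0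
        have := norm_apply_le_norm_cfc f T hx hf
        rw [h0, norm_zero] at this
        exact hfx (norm_le_zero_iff.1 this)
      refine hne _ hf t ht (by simp only [r]; rw [max_eq_left] <;> linarith) ?_
      refine hρ.eq_zero_of_mul_eq_zero (fun a => ?_)
        (hne _ hg s hs (by simp only [r]; rw [max_eq_left] <;> linarith)) h1
      refine (Commute.cfc_real ?_ _)
      exact hT a
    intro s hs t ht
    exact le_antisymm (not_lt.1 (key t ht s hs)) (not_lt.1 (key s hs t ht))
  obtain ⟨c, hc⟩ : ∃ c : ℝ, ∀ x ∈ spectrum ℝ T, x = c := by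
    rcases hspec.eq_empty_or_singleton with h | ⟨c, h⟩
    · exact ⟨0, by simp [h]⟩
    · exact ⟨c, by simp [h]⟩
  refine ⟨c, ?_⟩
  rw [← cfc_id' ℝ T, cfc_congr (g := fun _ => c) hc, cfc_const c T, Algebra.algebraMap_eq_smul_one]
  rfl

lemma exists_eq_smul_s16 (hρ : IsIrreducibleRep ρ) {T : K →L[ℂ] K} (hT : ∀ a, Commute T (ρ a)) :
    ∃ c : ℂ, T = c • 1 := by
  have hT' : ∀ a, Commute (star T) (ρ a) := fun a => by
    have := (hT (star a)).star_star
    rwa [map_star, star_star] at this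
  obtain ⟨c, hc⟩ := hρ.exists_eq_smul_of_isSelfAdjoint_s16 (T := (realPart T : K →L[ℂ] K))
    (fun a => by
      rw [realPart_apply_coe]
      exact ((hT a).add_left (hT' a)).smul_left _) (realPart T).2
  obtain ⟨d, hd⟩ := hρ.exists_eq_smul_of_isSelfAdjoint_s16 (T := (imaginaryPart T : K →L[ℂ] K))
    (fun a => by
      rw [imaginaryPart_apply_coe]
      exact (((hT a).sub_left (hT' a)).smul_left _).smul_left _) (imaginaryPart T).2
  refine ⟨c + Complex.I * d, ?_⟩
  conv_lhs => rw [← realPart_add_I_smul_imaginaryPart T, hc, hd]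
  module

/-- A weak form of the density theorem: a normal functional vanishing on the image of an
irreducible representation vanishes on every operator. -/
lemma sum_inner_apply_eq_zero (hρ : IsIrreducibleRep ρ) {ι : Type*} [Fintype ι] (u v : ι → K)
    (h : ∀ a, ∑ i, inner ℂ (u i) (ρ a (v i)) = 0) (T : K →L[ℂ] K) :
    ∑ i, inner ℂ (u i) (T (v i)) = 0 := by
  classical
  let V : PiLp 2 (fun _ : ι => K) := WithLp.toLp 2 v
  let U : PiLp 2 (fun _ : ι => K) := WithLp.toLp 2 u
  let f : E →ₗ[ℂ] PiLp 2 (fun _ : ι => K) :=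
    { toFun := fun a => diagCLM ι (ρ a) V
      map_add' := fun a b => by ext; simp
      map_smul' := fun c a => by ext; simp }
  let M : Submodule ℂ (PiLp 2 (fun _ : ι => K)) := (LinearMap.range f).topologicalClosure
  have : CompleteSpace M := (Submodule.isClosed_topologicalClosure _).completeSpace_coe
  have hfM : ∀ a, diagCLM ι (ρ a) V ∈ M := fun a => Submodule.le_topologicalClosure _ ⟨a, rfl⟩
  have hinv : ∀ a, ∀ x ∈ M, diagCLM ι (ρ a) x ∈ M := fun a =>
    Submodule.topologicalClosure_minimal (t := M.comap (diagCLM ι (ρ a)).toLinearMap) _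
      (by
        rintro _ ⟨b, rfl⟩
        have : diagCLM ι (ρ a) (f b) = diagCLM ι (ρ (a * b)) V := by ext; simp [f]
        simpa [this] using hfM (a * b))
      ((Submodule.isClosed_topologicalClosure _).preimage (diagCLM ι (ρ a)).continuous)
  have hinv' : ∀ a, ∀ x ∈ Mᗮ, diagCLM ι (ρ a) x ∈ Mᗮ := fun a x hx => by
    rw [Submodule.mem_orthogonal]
    intro y hy
    rw [← star_star a, map_star, ← star_diagCLM, ContinuousLinearMap.star_eq_adjoint,
      ContinuousLinearMap.adjoint_inner_right]
    exact (Submodule.mem_orthogonal _ _).1 hx _ (hinv (star a) y hy)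
  let P := M.starProjection
  have hP : ∀ a x, P (diagCLM ι (ρ a) x) = diagCLM ι (ρ a) (P x) := fun a x => by
    refine Submodule.eq_starProjection_of_mem_of_inner_eq_zero
      (hinv a _ (M.starProjection_apply_mem x)) ?_
    intro w hw
    rw [← map_sub]
    exact (Submodule.mem_orthogonal' _ _).1 (hinv' a _ (M.sub_starProjection_mem_orthogonal x)) w hw
  let s : ι → K →L[ℂ] PiLp 2 (fun _ : ι => K) := fun j =>
    (PiLp.continuousLinearEquiv 2 ℂ (fun _ : ι => K)).symm ∘L
      ContinuousLinearMap.single ℂ (fun _ : ι => K) j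
  have hs : ∀ (R : K →L[ℂ] K) j z, diagCLM ι R (s j z) = s j (R z) := fun R j z => by
    ext i
    rcases eq_or_ne i j with rfl | hij
    · simp [s]
    · simp [s, hij]
  have hsum : ∀ x, x = ∑ j, s j (x j) := fun x => by
    ext i
    simp [s, Finset.sum_apply, Pi.single_apply]
  let p : ι → ι → K →L[ℂ] K := fun i j => PiLp.proj 2 (fun _ : ι => K) i ∘L P ∘L s j
  have hp : ∀ i j, ∃ c : ℂ, p i j = c • 1 := fun i j => by
    refine hρ.exists_eq_smul_s16 fun a => ?_
    ext z
    simp [p, ← hs, hP]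
  choose c hc using hp
  have hPT : ∀ x, P (diagCLM ι T x) = diagCLM ι T (P x) := fun x => by
    rw [hsum x]
    simp only [map_sum, hs]
    refine Finset.sum_congr rfl fun j _ => ?_
    ext i
    have h1 : ∀ z, P (s j z) i = c i j • z := fun z => congr($(hc i j) z)
    simp [h1]
  have hV : P V = V := by
    rw [← sub_eq_zero]
    ext i
    refine hρ.eq_zero_of_forall_apply_eq_zero fun a => ?_
    have h1 : P (diagCLM ι (ρ a) V) = diagCLM ι (ρ a) V :=
      Submodule.starProjection_eq_self_iff.2 (hfM a)
    rw [hP] at h1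
    have h2 := congr($h1 i)
    simpa [sub_eq_zero] using h2
  have hU : U ∈ Mᗮ := by
    have : M ≤ (ℂ ∙ U)ᗮ := by
      refine Submodule.topologicalClosure_minimal _ ?_ (Submodule.isClosed_orthogonal _)
      rintro _ ⟨a, rfl⟩
      rw [Submodule.mem_orthogonal_singleton_iff_inner_right]
      simpa [PiLp.inner_apply, f] using h a
    rw [Submodule.mem_orthogonal]
    intro y hy
    exact Submodule.mem_orthogonal_singleton_iff_inner_left.1 (this hy)
  have hTV : diagCLM ι T V ∈ M := by
    rw [← Submodule.starProjection_eq_self_iff]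
    change P _ = _
    rw [hPT, hV]
  have := (Submodule.mem_orthogonal' _ _).1 hU _ hTV
  simpa [PiLp.inner_apply] using this

end IsIrreducibleRep

end Irreducible

section Density

variable {E : Type*} [NonUnitalCStarAlgebra E] {K : Type*} [NormedAddCommGroup K]
  [InnerProductSpace ℂ K] [CompleteSpace K] {ρ : E →⋆ₙₐ[ℂ] (K →L[ℂ] K)}

lemma IsSelfAdjoint.sum_inner_add_sum_inner {S : K →L[ℂ] K} (hS : IsSelfAdjoint S) {ι : Type*}
    [Fintype ι] (u v : ι → K) :
    ∑ i, inner ℂ (u i) (S (v i)) + ∑ i, inner ℂ (v i) (S (u i)) =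
      ((2 * (∑ i, inner ℂ (u i) (S (v i))).re : ℝ) : ℂ) := by
  have : ∑ i, inner ℂ (v i) (S (u i)) =
      (starRingEnd ℂ) (∑ i, inner ℂ (u i) (S (v i))) := by
    rw [map_sum]
    refine Finset.sum_congr rfl fun i _ => ?_
    rw [inner_conj_symm, ← ContinuousLinearMap.adjoint_inner_left,
      ← ContinuousLinearMap.star_eq_adjoint, hS.star_eq]
  rw [this, Complex.add_conj]

namespace IsIrreducibleRep

/-- The self-adjoint part of the density theorem. -/
lemma exists_isSelfAdjoint_norm_sub_lt (hρ : IsIrreducibleRep ρ) {ι : Type*} [Fintype ι]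
    (v : ι → K) {T : K →L[ℂ] K} (hT : IsSelfAdjoint T) {ε : ℝ} (hε : 0 < ε) :
    ∃ h : E, IsSelfAdjoint h ∧ ∀ i, ‖ρ h (v i) - T (v i)‖ < ε := by
  let V : PiLp 2 (fun _ : ι => K) := WithLp.toLp 2 v
  let f : E →ₗ[ℂ] PiLp 2 (fun _ : ι => K) :=
    { toFun := fun a => diagCLM ι (ρ a) V
      map_add' := fun a b => by ext; simp
      map_smul' := fun c a => by ext; simp }
  let R : Submodule ℝ (PiLp 2 (fun _ : ι => K)) :=
    (selfAdjoint.submodule ℝ E).map (f.restrictScalars ℝ)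
  by_cases hmem : diagCLM ι T V ∈ closure (R : Set (PiLp 2 (fun _ : ι => K)))
  · obtain ⟨_, ⟨h, hh, rfl⟩, hdist⟩ := Metric.mem_closure_iff.1 hmem ε hε
    refine ⟨h, hh, fun i => ?_⟩
    rw [dist_comm, dist_eq_norm] at hdist
    exact (PiLp.norm_apply_le _ i).trans_lt hdist
  exfalso
  obtain ⟨g, c, hg, hgT⟩ := RCLike.geometric_hahn_banach_closed_point (𝕜 := ℂ)
    R.convex.closure isClosed_closure hmem
  have hc : 0 < c := by simpa using hg 0 (subset_closure R.zero_mem)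
  have hre : ∀ x ∈ R, (g x).re = 0 := by
    intro x hx
    by_contra hne
    have := hg ((c / (g x).re) • x) (subset_closure (R.smul_mem _ hx))
    rw [RCLike.real_smul_eq_coe_smul (K := ℂ), map_smul] at this
    simp [hne] at this
  set U := (InnerProductSpace.toDual ℂ (PiLp 2 (fun _ : ι => K))).symm g
  have hgU : ∀ S : K →L[ℂ] K, g (diagCLM ι S V) = ∑ i, inner ℂ (U i) (S (v i)) := by
    intro S
    rw [← InnerProductSpace.toDual_symm_apply, PiLp.inner_apply]
    rfl
  have hsum := hρ.sum_inner_apply_eq_zero (Sum.elim U v) (Sum.elim v U) (fun a => by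
    have key : ∀ h : E, IsSelfAdjoint h →
        ∑ i, inner ℂ (U i) (ρ h (v i)) + ∑ i, inner ℂ (v i) (ρ h (U i)) = 0 := by
      intro h hh
      have : IsSelfAdjoint (ρ h) := hh.map ρ
      rw [this.sum_inner_add_sum_inner, ← hgU]
      have := hre _ (Submodule.mem_map_of_mem (f := f.restrictScalars ℝ) hh)
      simpa [f] using this
    have h1 := key _ (realPart a).2
    have h2 := key _ (imaginaryPart a).2
    rw [Fintype.sum_sum_type]
    conv_lhs => rw [← realPart_add_I_smul_imaginaryPart a]
    simp only [Sum.elim_inl, Sum.elim_inr, map_add, map_smul, add_apply, inner_add_right,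
      smul_apply, inner_smul_right, Finset.sum_add_distrib, ← Finset.mul_sum]
    linear_combination h1 + Complex.I * h2) T
  rw [Fintype.sum_sum_type] at hsum
  simp only [Sum.elim_inl, Sum.elim_inr] at hsum
  rw [hT.sum_inner_add_sum_inner, ← hgU] at hsum
  have h0 : (g (diagCLM ι T V)).re = 0 := by
    have := Complex.ofReal_eq_zero.1 hsum
    linarith
  have : c < (g (diagCLM ι T V)).re := hgT
  linarith

/-- A form of Kaplansky's density theorem: self-adjoint operators can be approximated by the
images of contractions on finitely many vectors on which they are involutive. -/
lemma exists_norm_le_one_norm_sub_le (hρ : IsIrreducibleRep ρ) {ι : Type*} [Fintype ι]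
    (v : ι → K) {T : K →L[ℂ] K} (hT : IsSelfAdjoint T) (hTT : ∀ i, T (T (v i)) = v i)
    {ε : ℝ} (hε : 0 < ε) :
    ∃ b : E, ‖b‖ ≤ 1 ∧ ∀ i, ‖ρ b (v i) - T (v i)‖ ≤ ε := by
  obtain ⟨h, hh, happ⟩ := hρ.exists_isSelfAdjoint_norm_sub_lt (Sum.elim v (T ∘ v)) hT
    (half_pos hε)
  set f : ℝ → ℝ := fun t => 2 * t / (1 + t ^ 2)
  have hden : ∀ t : ℝ, 0 < 1 + t ^ 2 := fun t => by positivity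
  have hf : Continuous f := by
    refine Continuous.div (by fun_prop) (by fun_prop) fun t => (hden t).ne'
  have hf0 : f 0 = 0 := by simp [f]
  have hrel : cfcₙ f h + h * (h * cfcₙ f h) = h + h := by
    have e1 : h * cfcₙ f h = cfcₙ (fun t => t * f t) h := by
      rw [cfcₙ_mul (fun t => t) f h (by fun_prop) rfl hf.continuousOn hf0, cfcₙ_id' ℝ h]
    have e2 : h * cfcₙ (fun t => t * f t) h = cfcₙ (fun t => t * (t * f t)) h := by
      rw [cfcₙ_mul (fun t => t) (fun t => t * f t) h (by fun_prop) rfl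
        (by fun_prop) (by simp), cfcₙ_id' ℝ h]
    have e3 : h + h = cfcₙ (fun t : ℝ => t + t) h := by
      rw [cfcₙ_add (fun t => t) (fun t => t) h (by fun_prop) rfl (by fun_prop) rfl, cfcₙ_id' ℝ h]
    rw [e1, e2, e3, ← cfcₙ_add f (fun t => t * (t * f t)) h hf.continuousOn hf0
      (by fun_prop) (by simp)]
    refine cfcₙ_congr fun t _ => ?_
    have := (hden t).ne'
    simp only [f]
    field_simp
    ring
  refine ⟨cfcₙ f h, norm_cfcₙ_le fun t _ => ?_, fun i => ?_⟩
  · rw [Real.norm_eq_abs, abs_div, abs_of_pos (hden t), div_le_one (hden t), abs_le]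
    constructor <;> nlinarith [sq_nonneg (t + 1), sq_nonneg (t - 1)]
  · have hp := (happ (Sum.inl i)).le
    have hq := (happ (Sum.inr i)).le
    simp only [Sum.elim_inl, Sum.elim_inr, Function.comp_apply, hTT] at hp hq
    set X := ρ h with hX
    have hXsa : IsSelfAdjoint X := hh.map ρ
    set w := T (v i)
    set z := ρ (cfcₙ f h) (v i) - w with hz
    have hz' : z + X (X z) = (X (v i) - w) - X (X w - v i) := by
      have := congr(ρ $hrel (v i))
      simp only [map_add, map_mul, add_apply, mul_apply_eq_comp, ← hX] at this
      simp only [hz, map_sub]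
      rw [← sub_eq_zero] at this ⊢
      rw [← this]
      abel
    clear_value z w X
    have h1 := congr(RCLike.re (inner ℂ z $hz'))
    have h2 : ∀ y, inner ℂ z (X y) = inner ℂ (X z) y := fun y => by
      rw [← ContinuousLinearMap.adjoint_inner_left, ← ContinuousLinearMap.star_eq_adjoint,
        hXsa.star_eq]
    rw [inner_add_right, inner_sub_right, h2, h2, map_add, map_sub,
      inner_self_eq_norm_sq, inner_self_eq_norm_sq] at h1
    have h3 := re_inner_le_norm z (X (v i) - w) (𝕜 := ℂ)
    have h4 := (neg_le_abs _).trans ((RCLike.abs_re_le_norm _).trans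
      (norm_inner_le_norm (X z) (X w - v i) (𝕜 := ℂ)))
    have h5 : ‖z‖ * ‖X (v i) - w‖ ≤ ‖z‖ * (ε / 2) := by gcongr
    have h6 : ‖X z‖ * ‖X w - v i‖ ≤ ‖X z‖ * (ε / 2) := by gcongr
    nlinarith [sq_nonneg (‖X z‖ - ε / 4), norm_nonneg z, norm_nonneg (X z)]

end IsIrreducibleRep

end Density

section Amplification

variable {ι E K : Type*} [Fintype ι] [NonUnitalCStarAlgebra E] [NormedAddCommGroup K]
  [InnerProductSpace ℂ K] [CompleteSpace K]

/-- The representation of the matrix algebra over `E` induced by a representation of `E`. -/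
def amplify (ι : Type*) [Fintype ι] (ρ : E →⋆ₙₐ[ℂ] (K →L[ℂ] K)) :
    CStarMatrix ι ι E →⋆ₙₐ[ℂ]
      (PiLp 2 (fun _ : ι => K) →L[ℂ] PiLp 2 (fun _ : ι => K)) where
  toFun M := matrixCLM fun i j => ρ (M i j)
  map_smul' c M := by
    ext x i
    simp [Finset.smul_sum]
  map_zero' := by
    ext x i
    simp
  map_add' M N := by
    ext x i
    simp [Finset.sum_add_distrib]
  map_mul' M N := by
    rw [matrixCLM_mul]
    simp [CStarMatrix.mul_apply]
  map_star' M := by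
    rw [star_matrixCLM]
    congr! with i j
    exact map_star ρ _

@[simp]
lemma amplify_apply (ρ : E →⋆ₙₐ[ℂ] (K →L[ℂ] K)) (M : CStarMatrix ι ι E)
    (x : PiLp 2 (fun _ : ι => K)) (i : ι) : amplify ι ρ M x i = ∑ j, ρ (M i j) (x j) :=
  matrixCLM_apply _ _ _

lemma amplify_single [DecidableEq ι] (ρ : E →⋆ₙₐ[ℂ] (K →L[ℂ] K)) (i j : ι) (a : E)
    (x : PiLp 2 (fun _ : ι => K)) :
    amplify ι ρ (CStarMatrix.ofMatrix (Matrix.single i j a)) x = PiLp.single 2 i (ρ a (x j)) := by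
  ext k
  rw [amplify_apply]
  rcases eq_or_ne i k with rfl | h
  · rw [PiLp.single_eq_same, Finset.sum_eq_single j]
    · simp
    · intro l _ hl
      simp [hl.symm]
    · simp
  · rw [PiLp.single_eq_of_ne _ h.symm]
    simp [h]

lemma IsIrreducibleRep.amplify [Nonempty ι] {ρ : E →⋆ₙₐ[ℂ] (K →L[ℂ] K)}
    (hρ : IsIrreducibleRep ρ) : IsIrreducibleRep (amplify ι ρ) := by
  classical
  refine ⟨?_, fun S hS hinv => ?_⟩
  · obtain ⟨a, ha⟩ := hρ.1
    obtain ⟨i⟩ := ‹Nonempty ι›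
    refine ⟨CStarMatrix.ofMatrix (Matrix.single i i a), fun h => ha ?_⟩
    ext z
    have := congr($h (PiLp.single 2 i z) i)
    rw [amplify_single] at this
    simpa using this
  · refine or_iff_not_imp_left.2 fun hbot => ?_
    obtain ⟨v, hv, hv0⟩ := S.ne_bot_iff.1 hbot
    obtain ⟨j, hj⟩ : ∃ j, v j ≠ 0 := by
      by_contra! h
      exact hv0 (by ext j; exact h j)
    have hsingle : ∀ i z, PiLp.single 2 i z ∈ S := fun i z => by
      let s : K →L[ℂ] PiLp 2 (fun _ : ι => K) :=
        (PiLp.continuousLinearEquiv 2 ℂ (fun _ : ι => K)).symm ∘L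
          ContinuousLinearMap.single ℂ (fun _ : ι => K) i
      have : S.comap s.toLinearMap = ⊤ := hρ.eq_top_of_forall_apply_mem hj
        (hS.preimage s.continuous) fun a => by
          have := hinv (CStarMatrix.ofMatrix (Matrix.single i j a)) v hv
          rwa [amplify_single] at this
      have hz : z ∈ S.comap s.toLinearMap := this ▸ Submodule.mem_top
      exact hz
    refine Submodule.eq_top_iff'.2 fun x => ?_
    have hx : x = ∑ i, PiLp.single 2 i (x i) := by
      ext i
      simp [Finset.sum_apply, Pi.single_apply]
    rw [hx]
    exact S.sum_mem fun i _ => hsingle i _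

/-- Contractions approximating the flip of two tensor factors. -/
lemma IsIrreducibleRep.exists_swap [Nonempty ι] [DecidableEq ι] [PartialOrder E]
    [StarOrderedRing E] {ρ : E →⋆ₙₐ[ℂ] (K →L[ℂ] K)} (hρ : IsIrreducibleRep ρ) {e : ι → K}
    (he : Orthonormal ℂ e) {ε : ℝ} (hε : 0 < ε) :
    ∃ x : CStarMatrix ι ι E, ‖x‖ ≤ 1 ∧
      ∀ r q p, ‖ρ (x r q) (e p) - if r = p then e q else 0‖ ≤ ε := by
  let T : PiLp 2 (fun _ : ι => K) →L[ℂ] PiLp 2 (fun _ : ι => K) :=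
    matrixCLM fun r q => InnerProductSpace.rankOne ℂ (e q) (e r)
  have hT : IsSelfAdjoint T := by
    rw [IsSelfAdjoint, star_matrixCLM]
    simp only [ContinuousLinearMap.star_eq_adjoint, InnerProductSpace.adjoint_rankOne, T]
  have hTs : ∀ q p, T (PiLp.single 2 q (e p)) = PiLp.single 2 p (e q) := fun q p => by
    ext r
    rw [matrixCLM_apply, Finset.sum_eq_single q]
    · rcases eq_or_ne r p with rfl | h
      · simp [he.1]
      · simp [h, he.2 h]
    · intro j _ hj
      simp [hj]
    · simp
  obtain ⟨x, hx, hx'⟩ := (hρ.amplify (ι := ι)).exists_norm_le_one_norm_sub_le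
    (fun k : ι × ι => PiLp.single 2 k.1 (e k.2)) hT (fun k => by rw [hTs, hTs]) hε
  refine ⟨x, hx, fun r q p => ?_⟩
  refine le_trans (le_of_eq ?_) ((PiLp.norm_apply_le _ r).trans (hx' (q, p)))
  rw [hTs, PiLp.sub_apply, amplify_apply, Finset.sum_eq_single q]
  · congr 2
    · simp
    · rcases eq_or_ne r p with rfl | h <;> simp [*]
  · intro j _ hj
    simp [hj]
  · simp

end Amplification

section MatrixNorm

variable {ι E : Type*} [Fintype ι] [NonUnitalCStarAlgebra E]

/-- The action of scalar matrices on matrices over `E` by left multiplication. -/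
def scalarMul (T : Matrix ι ι ℂ) (y : CStarMatrix ι ι E) : CStarMatrix ι ι E :=
  CStarMatrix.ofMatrix fun i k => ∑ j, T i j • y j k

lemma scalarMul_apply (T : Matrix ι ι ℂ) (y : CStarMatrix ι ι E) (i k : ι) :
    scalarMul T y i k = ∑ j, T i j • y j k := rfl

lemma star_scalarMul_mul_scalarMul (T : Matrix ι ι ℂ) (y : CStarMatrix ι ι E) :
    star (scalarMul T y) * scalarMul T y = star y * scalarMul (star T * T) y := by
  ext i k
  have h1 : ∀ a, (star (scalarMul T y) i a) * scalarMul T y a k =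
      ∑ j, ∑ l, (star (T a j) * T a l) • (star (y j i) * y l k) := fun a => by
    simp only [CStarMatrix.star_apply, scalarMul_apply, star_sum, star_smul, Finset.sum_mul_sum,
      smul_mul_smul_comm]
  have h2 : ∀ j, star y i j * scalarMul (star T * T) y j k =
      ∑ l, ∑ a, (star (T a j) * T a l) • (star (y j i) * y l k) := fun j => by
    simp only [CStarMatrix.star_apply, scalarMul_apply, Finset.mul_sum, Matrix.mul_apply,
      Matrix.star_apply, Finset.sum_smul, mul_smul_comm]
  simp only [CStarMatrix.mul_apply, h1, h2]
  rw [Finset.sum_comm]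
  exact Finset.sum_congr rfl fun _ _ => Finset.sum_comm

omit [Fintype ι] in
lemma CStarMatrix.sum_entry {κ : Type*} (s : Finset κ) (f : κ → CStarMatrix ι ι E) (i j : ι) :
    (∑ a ∈ s, f a) i j = ∑ a ∈ s, f a i j :=
  Matrix.sum_apply i j s f

variable [PartialOrder E] [StarOrderedRing E]

open scoped ComplexOrder in
lemma norm_scalarMul_le [DecidableEq ι] {T : Matrix ι ι ℂ} {C : ℝ} (hC : 0 ≤ C)
    (hT : (((C : ℂ) ^ 2) • (1 : Matrix ι ι ℂ) - star T * T).PosSemidef) (y : CStarMatrix ι ι E) :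
    ‖scalarMul T y‖ ≤ C * ‖y‖ := by
  open scoped MatrixOrder in
  obtain ⟨S, hS⟩ := CStarAlgebra.nonneg_iff_eq_star_mul_self.1 hT.nonneg
  have key : star (scalarMul T y) * scalarMul T y + star (scalarMul S y) * scalarMul S y =
      ((C : ℂ) ^ 2) • (star y * y) := by
    rw [star_scalarMul_mul_scalarMul, star_scalarMul_mul_scalarMul, ← hS, ← mul_add,
      ← mul_smul_comm]
    congr 1
    ext i k
    rw [CStarMatrix.add_apply]
    simp only [scalarMul_apply, ← Finset.sum_add_distrib, ← add_smul, Matrix.sub_apply,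
      add_sub_cancel]
    simp [Matrix.one_apply]
  have h1 : star (scalarMul T y) * scalarMul T y ≤ ((C : ℂ) ^ 2) • (star y * y) := by
    rw [← key]
    exact le_add_of_nonneg_right (star_mul_self_nonneg _)
  have h2 := CStarAlgebra.norm_le_norm_of_nonneg_of_le (star_mul_self_nonneg _) h1
  rw [norm_smul, CStarRing.norm_star_mul_self, CStarRing.norm_star_mul_self, norm_pow,
    Complex.norm_real, Real.norm_of_nonneg hC] at h2
  exact abs_le_of_sq_le_sq' (by linarith) (by positivity) |>.2

/-- The embedding of `E` as a diagonal corner of a matrix algebra over `E`. -/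
def cornerHom [DecidableEq ι] (i : ι) : E →⋆ₙₐ[ℂ] CStarMatrix ι ι E where
  toFun a := CStarMatrix.ofMatrix (Matrix.single i i a)
  map_smul' c a := by ext; simp [Matrix.single_apply]
  map_zero' := by ext; simp
  map_add' a b := by ext; simp [Matrix.single_add]
  map_mul' a b := by
    change _ = CStarMatrix.ofMatrix (Matrix.single i i a * Matrix.single i i b)
    simp
  map_star' a := by
    ext j k
    rcases eq_or_ne i j with rfl | hj <;> rcases eq_or_ne i k with rfl | hk <;>
      simp [CStarMatrix.star_apply, *]

lemma norm_le_card_mul {y : CStarMatrix ι ι E} {C : ℝ} (hC : 0 ≤ C) (hy : ∀ i j, ‖y i j‖ ≤ C) :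
    ‖y‖ ≤ Fintype.card ι * C := by
  classical
  let R : ι → CStarMatrix ι ι E := fun i =>
    CStarMatrix.ofMatrix fun k j => if k = i then y i j else 0
  have hRa : ∀ i k j, R i k j = if k = i then y i j else 0 := fun i k j => rfl
  have hR : ∀ i, ‖R i‖ * ‖R i‖ ≤ Fintype.card ι * (C * C) := fun i => by
    have : R i * star (R i) = cornerHom i (∑ j, y i j * star (y i j)) := by
      ext k l
      rw [CStarMatrix.mul_apply, map_sum, CStarMatrix.sum_entry]
      refine Finset.sum_congr rfl fun j _ => ?_
      by_cases hk : k = i <;> by_cases hl : l = i <;>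
        simp [hk, hl, hRa, cornerHom, CStarMatrix.star_apply, Ne.symm]
    rw [← CStarRing.norm_self_mul_star, this]
    refine (NonUnitalStarAlgHom.norm_apply_le (cornerHom (E := E) (ι := ι) i) _).trans
      ((norm_sum_le _ _).trans ?_)
    rw [← nsmul_eq_mul, ← Finset.card_univ, ← Finset.sum_const]
    refine Finset.sum_le_sum fun j _ => ?_
    rw [CStarRing.norm_self_mul_star]
    gcongr <;> exact hy i j
  have hsum : star y * y = ∑ i, star (R i) * R i := by
    ext j k
    simp [CStarMatrix.sum_entry, CStarMatrix.mul_apply, CStarMatrix.star_apply, hRa]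
  have h : ‖y‖ * ‖y‖ ≤ (Fintype.card ι * C) * (Fintype.card ι * C) := by
    rw [← CStarRing.norm_star_mul_self, hsum]
    refine (norm_sum_le _ _).trans ?_
    calc ∑ i, ‖star (R i) * R i‖ ≤ ∑ _i : ι, Fintype.card ι * (C * C) :=
          Finset.sum_le_sum fun i _ => by rw [CStarRing.norm_star_mul_self]; exact hR i
      _ = _ := by rw [Finset.sum_const, Finset.card_univ, nsmul_eq_mul]; ring
  exact abs_le_of_sq_le_sq' (by linarith) (by positivity) |>.2

lemma IsCStarNormOn.eq_norm_ofMatrix {N : Matrix ι ι E → ℝ} (hN : IsCStarNormOn _ N)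
    (x : Matrix ι ι E) : N x = ‖CStarMatrix.ofMatrix x‖ :=
  IsCStarNormOn.eq_norm (E := CStarMatrix ι ι E) (N := N)
    ⟨hN.eq_zero, hN.add_le, hN.smul, hN.mul_le, hN.star_mul_self⟩ x

end MatrixNorm

section Orthonormal

variable {H : Type*} [NormedAddCommGroup H] [InnerProductSpace ℂ H]

lemma exists_orthonormal_of_le_rank {d : ℕ} (h : (d : Cardinal) ≤ Module.rank ℂ H) :
    ∃ e : Fin d → H, Orthonormal ℂ e := by
  obtain ⟨f, hf⟩ := exists_linearIndependent_of_le_rank h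
  exact ⟨_, InnerProductSpace.gramSchmidtNormed_orthonormal hf⟩

open scoped ComplexOrder in
/-- The compression of an operator to the span of an orthonormal family is contractive; here the
matrix is transposed. -/
lemma Orthonormal.posSemidef_sub_compression [CompleteSpace H] {ι : Type*} [Fintype ι]
    [DecidableEq ι] {e : ι → H} (he : Orthonormal ℂ e) (X : H →L[ℂ] H) {C : ℝ} (hX : ‖X‖ ≤ C) :
    (((C : ℂ) ^ 2) • (1 : Matrix ι ι ℂ) -
      star (Matrix.of fun i j => inner ℂ (e j) (X (e i))) *
        Matrix.of fun i j => inner ℂ (e j) (X (e i))).PosSemidef := by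
  set T : Matrix ι ι ℂ := Matrix.of fun i j => inner ℂ (e j) (X (e i))
  refine .of_dotProduct_mulVec_nonneg ?_ fun z => ?_
  · simp [Matrix.IsHermitian, Matrix.star_eq_conjTranspose]
  · set u : H := ∑ j, star (z j) • e j
    have hu : ‖u‖ ^ 2 = ∑ j, ‖z j‖ ^ 2 := by
      rw [← inner_self_eq_norm_sq (𝕜 := ℂ), he.inner_sum, map_sum]
      refine Finset.sum_congr rfl fun j _ => ?_
      simp [Complex.mul_conj', ← Complex.ofReal_pow]
    have hTz : ∀ i, ‖T.mulVec z i‖ = ‖inner ℂ (e i) (star X u)‖ := fun i => by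
      rw [ContinuousLinearMap.star_eq_adjoint, ContinuousLinearMap.adjoint_inner_right,
        ← inner_conj_symm, RCLike.norm_conj]
      congr 1
      simp [u, sum_inner, inner_smul_left, Matrix.mulVec, dotProduct, T, mul_comm]
    have h1 : ∑ i, ‖T.mulVec z i‖ ^ 2 ≤ C ^ 2 * ∑ j, ‖z j‖ ^ 2 := by
      simp only [hTz]
      refine (he.sum_inner_products_le _).trans ?_
      rw [← hu, ← mul_pow]
      gcongr
      refine (ContinuousLinearMap.le_opNorm _ _).trans ?_
      rw [norm_star]
      gcongr
    have hdot : ∀ w : ι → ℂ, star w ⬝ᵥ w = ((∑ i, ‖w i‖ ^ 2 : ℝ) : ℂ) := fun w => by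
      simp [dotProduct, Complex.conj_mul']
    rw [Matrix.sub_mulVec, dotProduct_sub, Matrix.smul_mulVec, Matrix.one_mulVec,
      dotProduct_smul, ← Matrix.mulVec_mulVec, Matrix.dotProduct_mulVec,
      Matrix.star_eq_conjTranspose, ← Matrix.star_mulVec, hdot, hdot, smul_eq_mul]
    exact_mod_cast sub_nonneg.2 h1

end Orthonormal

section TransposeMap

open Filter Topology

variable {ι A B H K : Type*} [Fintype ι] [NonUnitalCStarAlgebra A] [NonUnitalCStarAlgebra B]
  [NormedAddCommGroup H] [InnerProductSpace ℂ H] [CompleteSpace H]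
  [NormedAddCommGroup K] [InnerProductSpace ℂ K] [CompleteSpace K]

lemma norm_sum_inner_le [PartialOrder B] [StarOrderedRing B] (σ : B →⋆ₙₐ[ℂ] (K →L[ℂ] K))
    {f : ι → K} (hf : Orthonormal ℂ f) (y : CStarMatrix ι ι B) :
    ‖∑ p, ∑ q, inner ℂ (f p) (σ (y p q) (f q))‖ ≤ ‖y‖ * Fintype.card ι := by
  let Ω : PiLp 2 (fun _ : ι => K) := WithLp.toLp 2 f
  have hΩ : ‖Ω‖ ^ 2 = Fintype.card ι := by
    simp [PiLp.norm_sq_eq_of_L2, Ω, hf.1]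
  have h : ∑ p, ∑ q, inner ℂ (f p) (σ (y p q) (f q)) = inner ℂ Ω (amplify ι σ y Ω) := by
    simp [PiLp.inner_apply, Ω, inner_sum]
  rw [h, ← hΩ]
  calc ‖inner ℂ Ω (amplify ι σ y Ω)‖ ≤ ‖Ω‖ * (‖amplify ι σ y‖ * ‖Ω‖) :=
        (norm_inner_le_norm _ _).trans (by gcongr; exact ContinuousLinearMap.le_opNorm _ _)
    _ ≤ ‖Ω‖ * (‖y‖ * ‖Ω‖) := by gcongr; exact NonUnitalStarAlgHom.norm_apply_le _ _
    _ = ‖y‖ * ‖Ω‖ ^ 2 := by ring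

lemma IsIrreducibleRep.exists_seq_tendsto_swap [Nonempty ι] [DecidableEq ι] [PartialOrder B]
    [StarOrderedRing B] {σ : B →⋆ₙₐ[ℂ] (K →L[ℂ] K)} (hσ : IsIrreducibleRep σ) {f : ι → K}
    (hf : Orthonormal ℂ f) :
    ∃ y : ℕ → CStarMatrix ι ι B, (∀ m, ‖y m‖ ≤ 1) ∧
      ∀ r q p, Tendsto (fun m => σ (y m r q) (f p)) atTop (𝓝 (if r = p then f q else 0)) := by
  choose y hy hy' using fun m : ℕ => hσ.exists_swap hf (Nat.one_div_pos_of_nat (α := ℝ) (n := m))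
  refine ⟨y, hy, fun r q p => ?_⟩
  rw [tendsto_iff_norm_sub_tendsto_zero]
  exact squeeze_zero (fun _ => norm_nonneg _) (fun m => hy' m r q p)
    tendsto_one_div_add_atTop_nhds_zero_nat

/-- The map `a ↦ c* (T ⊗ 1) c`, where `T` is the transpose of the compression of `ρ a` to the
span of the family `e`. -/
def transposeMap (ρ : A →⋆ₙₐ[ℂ] (H →L[ℂ] H)) (e : ι → H) (c : ι → B) : A →ₗ[ℂ] B where
  toFun a := ∑ i, star (c i) * ∑ j, inner ℂ (e j) (ρ a (e i)) • c j
  map_add' a b := by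
    simp [add_smul, Finset.sum_add_distrib, mul_add]
  map_smul' z a := by
    simp [mul_smul, Finset.smul_sum, Finset.mul_sum, mul_smul_comm]

lemma transposeMap_apply (ρ : A →⋆ₙₐ[ℂ] (H →L[ℂ] H)) (e : ι → H) (c : ι → B) (a : A) :
    transposeMap ρ e c a = ∑ i, star (c i) * ∑ j, inner ℂ (e j) (ρ a (e i)) • c j := rfl

lemma norm_transposeMap_le [PartialOrder B] [StarOrderedRing B] (ρ : A →⋆ₙₐ[ℂ] (H →L[ℂ] H))
    {e : ι → H} (he : Orthonormal ℂ e) {y : CStarMatrix ι ι B} (hy : ‖y‖ ≤ 1) (k : ι) (a : A) :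
    ‖transposeMap ρ e (fun i => y i k) a‖ ≤ ‖a‖ := by
  classical
  set T : Matrix ι ι ℂ := Matrix.of fun i j => inner ℂ (e j) (ρ a (e i))
  have h : transposeMap ρ e (fun i => y i k) a = (star y * scalarMul T y) k k := by
    simp [transposeMap_apply, CStarMatrix.mul_apply, CStarMatrix.star_apply, scalarMul_apply, T]
  rw [h]
  calc ‖(star y * scalarMul T y) k k‖ ≤ ‖star y‖ * ‖scalarMul T y‖ :=
        CStarMatrix.norm_entry_le_norm.trans (norm_mul_le _ _)
    _ ≤ 1 * (‖a‖ * 1) := by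
        rw [norm_star]
        gcongr
        exact (norm_scalarMul_le (norm_nonneg a) (he.posSemidef_sub_compression (ρ a)
          (NonUnitalStarAlgHom.norm_apply_le ρ a)) y).trans (by gcongr)
    _ = ‖a‖ := by ring

lemma inner_transposeMap_apply (ρ : A →⋆ₙₐ[ℂ] (H →L[ℂ] H)) (σ : B →⋆ₙₐ[ℂ] (K →L[ℂ] K))
    (e : ι → H) (c : ι → B) (a : A) (u v : K) :
    inner ℂ u (σ (transposeMap ρ e c a) v) =
      ∑ i, ∑ j, inner ℂ (e j) (ρ a (e i)) * inner ℂ (σ (c i) u) (σ (c j) v) := by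
  simp [transposeMap_apply, map_star, ContinuousLinearMap.star_eq_adjoint,
    ContinuousLinearMap.adjoint_inner_right]

lemma tendsto_sum_inner_transposeMap [DecidableEq ι] {ρ : A →⋆ₙₐ[ℂ] (H →L[ℂ] H)}
    {σ : B →⋆ₙₐ[ℂ] (K →L[ℂ] K)} {e : ι → H} (he : Orthonormal ℂ e) {f : ι → K}
    (hf : Orthonormal ℂ f) {x : ℕ → CStarMatrix ι ι A} {y : ℕ → CStarMatrix ι ι B}
    (hx : ∀ r q p, Tendsto (fun m => ρ (x m r q) (e p)) atTop (𝓝 (if r = p then e q else 0)))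
    (hy : ∀ r q p, Tendsto (fun m => σ (y m r q) (f p)) atTop (𝓝 (if r = p then f q else 0)))
    (k : ι) :
    Tendsto (fun m => ∑ p, ∑ q, inner ℂ (f p)
      (σ (transposeMap ρ e (fun i => y m i k) (x m p q)) (f q))) atTop
      (𝓝 ((Fintype.card ι : ℂ) ^ 2)) := by
  simp only [inner_transposeMap_apply]
  have hlim : (Fintype.card ι : ℂ) ^ 2 = ∑ p : ι, ∑ q : ι, ∑ i : ι, ∑ j : ι,
      inner ℂ (e j) (if p = i then e q else 0) *
        inner ℂ (if i = p then f k else 0) (if j = q then f k else 0) := by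
    have : ∀ p q i j : ι, inner ℂ (e j) (if p = i then e q else 0) *
        inner ℂ (if i = p then f k else 0) (if j = q then f k else 0) =
        if i = p then (if j = q then (1 : ℂ) else 0) else 0 := fun p q i j => by
      rcases eq_or_ne i p with rfl | hi <;> rcases eq_or_ne j q with rfl | hj <;>
        simp [*, he.1, hf.1, Ne.symm]
    simp [this, sq]
  rw [hlim]
  exact tendsto_finsetSum _ fun p _ => tendsto_finsetSum _ fun q _ =>
    tendsto_finsetSum _ fun i _ => tendsto_finsetSum _ fun j _ =>
      (tendsto_const_nhds.inner (hx p q i)).mul ((hy i k p).inner (hy j k q))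

end TransposeMap

/-- Let `A` and `B` be C*-algebras each admitting an irreducible
representation of dimension at least `n + 1`.  Then there is a linear map `A → B` which is
`n`-contractive but not `(n+1)`-contractive. -/
theorem stmt16 (n : ℕ) (hn : 1 ≤ n) (A B : Type) [NonUnitalCStarAlgebra A]
    [NonUnitalCStarAlgebra B]
    (hA : Nonempty (HasIrrepOfDimGe A (n + 1))) (hB : Nonempty (HasIrrepOfDimGe B (n + 1))) :
    ∃ φ : A →ₗ[ℂ] B, KContractive n φ ∧ NotKContractive (n + 1) φ := by
  obtain ⟨⟨H, ρ, hρ, hH⟩⟩ := hA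
  obtain ⟨⟨K, σ, hσ, hK⟩⟩ := hB
  let _ : PartialOrder A := CStarAlgebra.spectralOrder A
  have _ : StarOrderedRing A := CStarAlgebra.spectralOrderedRing A
  let _ : PartialOrder B := CStarAlgebra.spectralOrder B
  have _ : StarOrderedRing B := CStarAlgebra.spectralOrderedRing B
  obtain ⟨e, he⟩ := exists_orthonormal_of_le_rank hH
  obtain ⟨f, hf⟩ := exists_orthonormal_of_le_rank hK
  obtain ⟨x, hx1, hx⟩ := hρ.exists_seq_tendsto_swap he
  obtain ⟨y, hy1, hy⟩ := hσ.exists_seq_tendsto_swap hf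
  have hn0 : (0 : ℝ) < n := by exact_mod_cast hn
  have hlt : (n : ℝ) * (n + 1) < ‖((Fintype.card (Fin (n + 1)) : ℂ) ^ 2)‖ := by
    rw [norm_pow, Complex.norm_natCast, Fintype.card_fin]
    push_cast
    nlinarith
  obtain ⟨m, hm⟩ :=
    ((tendsto_sum_inner_transposeMap he hf hx hy 0).norm.eventually_const_lt hlt).exists
  set ψ := transposeMap ρ e (fun i => y m i 0)
  refine ⟨(n : ℂ)⁻¹ • ψ, fun NA NB hNA hNB a => ?_, fun NA NB hNA hNB =>
    ⟨CStarMatrix.ofMatrix.symm (x m), ?_⟩⟩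
  · rw [hNA.eq_norm_ofMatrix, hNB.eq_norm_ofMatrix]
    refine (norm_le_card_mul (C := (n : ℝ)⁻¹ * ‖CStarMatrix.ofMatrix a‖) (by positivity)
      fun i j => ?_).trans_eq ?_
    · change ‖(n : ℂ)⁻¹ • ψ (a i j)‖ ≤ _
      rw [norm_smul, norm_inv, Complex.norm_natCast]
      gcongr
      exact (norm_transposeMap_le ρ he (hy1 m) 0 (a i j)).trans
        (CStarMatrix.norm_entry_le_norm (M := CStarMatrix.ofMatrix a))
    · rw [Fintype.card_fin, mul_inv_cancel_left₀ hn0.ne']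
  · set z := CStarMatrix.ofMatrix.symm (x m)
    have hmap : z.map ((n : ℂ)⁻¹ • ψ) = (n : ℂ)⁻¹ • z.map ψ := rfl
    rw [hNA.eq_norm_ofMatrix, hmap, hNB.smul, hNB.eq_norm_ofMatrix, norm_inv,
      Complex.norm_natCast]
    refine (hx1 m).trans_lt ?_
    have h := hm.trans_le (norm_sum_inner_le σ hf (CStarMatrix.ofMatrix (z.map ψ)))
    rw [Fintype.card_fin, Nat.cast_succ] at h
    rw [inv_mul_eq_div, one_lt_div hn0]
    exact lt_of_mul_lt_mul_right h (by positivity)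

end
end
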